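/- Let s > 1/2, u ∈ 𝒮'(ℝ^d) a tempered distribution, and (y,η) ∈ ℝ^{2d}. Let Π(y,η)u ∈ 𝒮'(ℝ^d) be the phase-space translate of u, i.e. the tempered distribution defined by ⟨Π(y,η)u, φ⟩ = ⟨u, t ↦ e^{i⟨t+y,η⟩} φ(t+y)⟩ for Schwartz φ (formally Π(y,η)u = e^{i⟨·,η⟩} u(·−y)). Then WF^s(Π(y,η)u) = WF^s(u). -/

import Mathlib

open MeasureTheory Filter
open scoped BigOperators ENNReal RealInnerProductSpace

noncomputable section

/-- `ℝ^d` with the Euclidean norm. -/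
abbrev Ed (d : ℕ) : Type := EuclideanSpace ℝ (Fin d)

/-- Partial derivative along the `i`-th coordinate direction. -/
def pdGS {d : ℕ} (i : Fin d) (f : Ed d → ℂ) : Ed d → ℂ :=
  fun x => fderiv ℝ f x (EuclideanSpace.single i 1)

/-- Multi-index partial derivative `∂^β`. -/
def mderiv {d : ℕ} (β : Fin d → ℕ) (f : Ed d → ℂ) : Ed d → ℂ :=
  ((List.ofFn fun i : Fin d => (pdGS i)^[β i]).foldr (· ∘ ·) id) f

/-- Monomial `x^α`. -/
def mpow {d : ℕ} (x : Ed d) (α : Fin d → ℕ) : ℝ := ∏ i, x i ^ α i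

/-- Multi-index factorial `α!`. -/
def mfact {d : ℕ} (α : Fin d → ℕ) : ℕ := ∏ i, Nat.factorial (α i)

/-- Multi-index length `|α|`. -/
def mlen {d : ℕ} (α : Fin d → ℕ) : ℕ := ∑ i, α i

/-- The Gelfand–Shilov seminorm `‖f‖_{S_{s,h}}`, valued in `[0,∞]`. -/
def GSnorm {d : ℕ} (s h : ℝ) (f : Ed d → ℂ) : ℝ≥0∞ :=
  ⨆ (x : Ed d) (α : Fin d → ℕ) (β : Fin d → ℕ),
    ENNReal.ofReal (|mpow x α| * ‖mderiv β f x‖ /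
      (h ^ (mlen α + mlen β) * ((mfact α : ℝ) * (mfact β : ℝ)) ^ s))

/-- The Gelfand–Shilov space `Σ_s(ℝ^d)`: smooth functions all of whose
`S_{s,h}` seminorms are finite. -/
def SigmaGS (s : ℝ) (d : ℕ) : Set (Ed d → ℂ) :=
  {f | ContDiff ℝ ((⊤ : ℕ∞) : WithTop ℕ∞) f ∧ ∀ h : ℝ, 0 < h → GSnorm s h f < ⊤}

/-- The seminorm `|f|_A`, valued in `[0,∞]`. -/
def GSnormA {d : ℕ} (s A : ℝ) (f : Ed d → ℂ) : ℝ≥0∞ :=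
  ⨆ (x : Ed d) (β : Fin d → ℕ),
    ENNReal.ofReal (A ^ mlen β * Real.exp (A * ‖x‖ ^ (1/s)) * ‖mderiv β f x‖ /
      (mfact β : ℝ) ^ s)

/-- The Fourier transform `f̂(ξ) = ∫ f(x) e^{-i⟨x,ξ⟩} dx`. -/
def FTgs {d : ℕ} (f : Ed d → ℂ) (ξ : Ed d) : ℂ :=
  ∫ x : Ed d, f x * Complex.exp (-(Complex.I * (⟪x, ξ⟫ : ℝ)))

/-- The short-time Fourier transform of a function `f` with window `φ`. -/
def STFTgs {d : ℕ} (φ f : Ed d → ℂ) (z : Ed d × Ed d) : ℂ :=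
  ∫ y : Ed d, f y * (starRingEnd ℂ) (φ (y - z.1)) * Complex.exp (-(Complex.I * (⟪y, z.2⟫ : ℝ)))

/-- Euclidean norm of a phase-space point `(x,ξ) ∈ ℝ^{2d}`. -/
def pnorm {d : ℕ} (z : Ed d × Ed d) : ℝ := Real.sqrt (‖z.1‖ ^ 2 + ‖z.2‖ ^ 2)

/-- A conic subset: invariant under multiplication by positive reals. -/
def IsConic {V : Type*} [SMul ℝ V] (Γ : Set V) : Prop :=
  ∀ t : ℝ, 0 < t → ∀ z ∈ Γ, t • z ∈ Γ

/-- Tempered distributions on `ℝ^d`. -/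
abbrev TD (d : ℕ) : Type := SchwartzMap (Ed d) ℂ →L[ℂ] ℂ

/-- `W` is the short-time Fourier transform `V_φ u` of the tempered distribution `u`
with respect to the window `φ`. -/
def IsSTFT {d : ℕ} (u : TD d) (φ : Ed d → ℂ) (W : Ed d × Ed d → ℂ) : Prop :=
  ∀ (x ξ : Ed d) (g : SchwartzMap (Ed d) ℂ),
    (∀ y : Ed d, g y = (starRingEnd ℂ) (φ (y - x)) * Complex.exp (-(Complex.I * (⟪y, ξ⟫ : ℝ)))) →
    W (x, ξ) = u g

/-- The `s`-Gelfand–Shilov wave front set of a distribution whose short-time Fourier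
transform is `W`: the set of nonzero phase-space points having no open conic
neighbourhood on which `e^{A|z|^{1/s}} |W(z)|` is bounded for every `A > 0`. -/
def WFs {d : ℕ} (s : ℝ) (W : Ed d × Ed d → ℂ) : Set (Ed d × Ed d) :=
  {z₀ | z₀ ≠ 0 ∧ ¬ ∃ Γ : Set (Ed d × Ed d), IsOpen Γ ∧ IsConic Γ ∧
    (0 : Ed d × Ed d) ∉ Γ ∧ z₀ ∈ Γ ∧
    ∀ A : ℝ, 0 < A → ∃ C : ℝ, ∀ z ∈ Γ, Real.exp (A * pnorm z ^ (1/s)) * ‖W z‖ ≤ C}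

/-- The real quadratic form `⟨Bx, x⟩` of a matrix `B`. -/
def qf {d : ℕ} (B : Matrix (Fin d) (Fin d) ℝ) (x : Ed d) : ℝ :=
  ∑ i, (∑ j, B i j * x j) * x i

/-- Tempered distributions on `ℝ^m × ℝ^n`. -/
abbrev TD2 (m n : ℕ) : Type := SchwartzMap (Ed m × Ed n) ℂ →L[ℂ] ℂ

/-- Short-time Fourier transform of a tempered distribution on `ℝ^m × ℝ^n`. -/
def IsSTFT2 {m n : ℕ} (w : TD2 m n) (Φ : Ed m × Ed n → ℂ)
    (W : (Ed m × Ed n) × (Ed m × Ed n) → ℂ) : Prop :=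
  ∀ (x ξ : Ed m × Ed n) (g : SchwartzMap (Ed m × Ed n) ℂ),
    (∀ y : Ed m × Ed n, g y = (starRingEnd ℂ) (Φ (y - x)) *
      Complex.exp (-(Complex.I * ((⟪y.1, ξ.1⟫ + ⟪y.2, ξ.2⟫ : ℝ))))) →
    W (x, ξ) = w g

/-- Euclidean norm of a phase-space point of `T^*(ℝ^m × ℝ^n)`. -/
def pnorm2 {m n : ℕ} (z : (Ed m × Ed n) × (Ed m × Ed n)) : ℝ :=
  Real.sqrt (‖z.1.1‖ ^ 2 + ‖z.1.2‖ ^ 2 + ‖z.2.1‖ ^ 2 + ‖z.2.2‖ ^ 2)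

/-- The `s`-Gelfand–Shilov wave front set on `ℝ^m × ℝ^n`. -/
def WFs2 {m n : ℕ} (s : ℝ) (W : (Ed m × Ed n) × (Ed m × Ed n) → ℂ) :
    Set ((Ed m × Ed n) × (Ed m × Ed n)) :=
  {z₀ | z₀ ≠ 0 ∧ ¬ ∃ Γ : Set ((Ed m × Ed n) × (Ed m × Ed n)), IsOpen Γ ∧ IsConic Γ ∧
    (0 : (Ed m × Ed n) × (Ed m × Ed n)) ∉ Γ ∧ z₀ ∈ Γ ∧
    ∀ A : ℝ, 0 < A → ∃ C : ℝ, ∀ z ∈ Γ, Real.exp (A * pnorm2 z ^ (1/s)) * ‖W z‖ ≤ C}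

/-- Points of `E` together with `n` directions of norm at most one. -/
abbrev PointDirs (E : Type*) [NormedAddCommGroup E] (n : ℕ) : Type _ :=
  E × {m : Fin n → E // ∀ i, ‖m i‖ ≤ 1}

lemma norm_iteratedFDeriv_apply_le_of_unit {E : Type*} [NormedAddCommGroup E] [NormedSpace ℝ E]
    {n : ℕ} (f : E → ℂ) (p : PointDirs E n) :
    ‖iteratedFDeriv ℝ n f p.1 p.2.1‖ ≤ ‖iteratedFDeriv ℝ n f p.1‖ := by
  refine (ContinuousMultilinearMap.le_opNorm _ _).trans ?_
  refine mul_le_of_le_one_right (norm_nonneg _) ?_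
  exact Finset.prod_le_one (fun _ _ => norm_nonneg _) fun i _ => p.2.2 i

/-- The weighted derivative `(x, m) ↦ ‖x‖ ^ k * D^n f x m` of a Schwartz function, as a bounded
continuous function. -/
def weightedDeriv (E : Type*) [NormedAddCommGroup E] [NormedSpace ℝ E] (k n : ℕ) :
    SchwartzMap E ℂ →L[ℂ] BoundedContinuousFunction (PointDirs E n) ℂ :=
  SchwartzMap.mkCLMtoNormedSpace (σ := RingHom.id ℂ)
    (fun f => BoundedContinuousFunction.ofNormedAddCommGroup
      (fun p => ((‖p.1‖ ^ k : ℝ) : ℂ) * iteratedFDeriv ℝ n f p.1 p.2.1)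
      (by
        have h1 := (f.smooth ⊤).continuous_iteratedFDeriv (m := n) (by exact_mod_cast le_top)
        have h2 : Continuous fun p : PointDirs E n => iteratedFDeriv ℝ n f p.1 p.2.1 :=
          (h1.comp continuous_fst).eval (continuous_subtype_val.comp continuous_snd)
        fun_prop)
      (SchwartzMap.seminorm ℂ k n f)
      (fun p => by
        rw [norm_mul, Complex.norm_real, norm_pow, norm_norm]
        refine le_trans ?_ (SchwartzMap.le_seminorm ℂ k n f p.1)
        gcongr
        exact norm_iteratedFDeriv_apply_le_of_unit f p))
    (fun f g => by
      ext1 p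
      have hf := (f.smooth n).contDiffAt (x := p.1)
      have hg := (g.smooth n).contDiffAt (x := p.1)
      have : ⇑(f + g) = ⇑f + ⇑g := rfl
      simp [this, iteratedFDeriv_add_apply hf hg, mul_add])
    (fun a f => by
      ext1 p
      have hf := (f.smooth n).contDiffAt (x := p.1)
      have : ⇑(a • f) = a • ⇑f := rfl
      simp only [BoundedContinuousFunction.coe_ofNormedAddCommGroup, this, RingHom.id_apply,
        BoundedContinuousFunction.coe_smul]
      rw [iteratedFDeriv_const_smul_apply hf]
      simp only [_root_.smul_apply, smul_eq_mul]
      ring)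
    ⟨{(k, n)}, 1, zero_le_one, fun f => by
      rw [one_mul, Finset.sup_singleton]
      exact BoundedContinuousFunction.norm_ofNormedAddCommGroup_le _ (apply_nonneg _ _) _⟩

lemma weightedDeriv_apply {E : Type*} [NormedAddCommGroup E] [NormedSpace ℝ E] (k n : ℕ)
    (f : SchwartzMap E ℂ) (p : PointDirs E n) :
    weightedDeriv E k n f p = ((‖p.1‖ ^ k : ℝ) : ℂ) * iteratedFDeriv ℝ n f p.1 p.2.1 := rfl

lemma norm_weightedDeriv_le {E : Type*} [NormedAddCommGroup E] [NormedSpace ℝ E] (k n : ℕ)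
    (f : SchwartzMap E ℂ) : ‖weightedDeriv E k n f‖ ≤ SchwartzMap.seminorm ℂ k n f := by
  refine (BoundedContinuousFunction.norm_le (apply_nonneg _ _)).2 fun p => ?_
  rw [weightedDeriv_apply, norm_mul, Complex.norm_real, norm_pow, norm_norm]
  refine le_trans ?_ (SchwartzMap.le_seminorm ℂ k n f p.1)
  gcongr
  exact norm_iteratedFDeriv_apply_le_of_unit f p

lemma seminorm_le_norm_weightedDeriv {E : Type*} [NormedAddCommGroup E] [NormedSpace ℝ E] (k n : ℕ)
    (f : SchwartzMap E ℂ) : SchwartzMap.seminorm ℂ k n f ≤ ‖weightedDeriv E k n f‖ := by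
  refine SchwartzMap.seminorm_le_bound ℂ k n f (norm_nonneg (weightedDeriv E k n f)) fun x => ?_
  rw [← norm_norm x, ← norm_pow, ← norm_smul]
  refine ContinuousMultilinearMap.opNorm_le_bound (norm_nonneg (weightedDeriv E k n f)) fun m => ?_
  have hm : m = fun i => ‖m i‖ • (‖m i‖⁻¹ • m i) := by
    funext i
    by_cases h : m i = 0
    · simp [h]
    · rw [smul_inv_smul₀ (norm_ne_zero_iff.2 h)]
  have hu : ∀ i, ‖‖m i‖⁻¹ • m i‖ ≤ 1 := fun i => by
    rw [norm_smul, norm_inv, norm_norm]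
    exact inv_mul_le_one
  have := (weightedDeriv E k n f).norm_coe_le_norm (x, ⟨fun i => ‖m i‖⁻¹ • m i, hu⟩)
  rw [weightedDeriv_apply, norm_mul, Complex.norm_real] at this
  rw [_root_.smul_apply, norm_smul]
  conv_lhs => rw [hm, ContinuousMultilinearMap.map_smul_univ]
  rw [norm_smul, Real.norm_of_nonneg (Finset.prod_nonneg fun _ _ => norm_nonneg _),
    mul_left_comm, mul_comm]
  gcongr

lemma seminorm_lineDerivOp_le {E : Type*} [NormedAddCommGroup E] [NormedSpace ℝ E] (k n : ℕ) (m : E)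
    (f : SchwartzMap E ℂ) :
    SchwartzMap.seminorm ℂ k n (LineDeriv.lineDerivOp m f) ≤
      ‖m‖ * SchwartzMap.seminorm ℂ k (n + 1) f := by
  refine SchwartzMap.seminorm_le_bound ℂ k n _ (by positivity) fun x => ?_
  have hfd : ContDiff ℝ n (fderiv ℝ f) := (f.smooth (n + 1)).fderiv_right (by norm_cast)
  have h : ‖iteratedFDeriv ℝ n (LineDeriv.lineDerivOp m f : SchwartzMap E ℂ) x‖ ≤
      ‖m‖ * ‖iteratedFDeriv ℝ (n + 1) f x‖ := by
    have hcoe : ⇑(LineDeriv.lineDerivOp m f : SchwartzMap E ℂ) = fun y => fderiv ℝ f y m := by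
      ext y
      rw [SchwartzMap.lineDerivOp_apply_eq_fderiv]
    rw [hcoe, ← norm_iteratedFDeriv_fderiv]
    exact norm_iteratedFDeriv_clm_apply_const hfd.contDiffAt le_rfl
  calc _ ≤ ‖x‖ ^ k * (‖m‖ * ‖iteratedFDeriv ℝ (n + 1) f x‖) := by gcongr
    _ = ‖m‖ * (‖x‖ ^ k * ‖iteratedFDeriv ℝ (n + 1) f x‖) := by ring
    _ ≤ _ := by
      gcongr
      exact SchwartzMap.le_seminorm ℂ k (n + 1) f x

section Exchange

variable {E Z : Type*} [NormedAddCommGroup E] [NormedSpace ℝ E] [TopologicalSpace Z]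
  [MeasurableSpace Z] [OpensMeasurableSpace Z] {μ : Measure Z}

lemma integrable_weightedDeriv [SecondCountableTopology Z] {F : Z → SchwartzMap E ℂ}
    (hF : Continuous F)
    (h_int : ∀ k n, Integrable (fun z => SchwartzMap.seminorm ℂ k n (F z)) μ) (k n : ℕ) :
    Integrable (fun z => weightedDeriv E k n (F z)) μ :=
  (h_int k n).mono' (((weightedDeriv E k n).continuous.comp hF).aestronglyMeasurable)
    (ae_of_all _ fun _ => norm_weightedDeriv_le k n _)

lemma lineDerivOp_apply_integral {F : Z → SchwartzMap E ℂ} (hF : Continuous F)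
    (h_int : ∀ k n, Integrable (fun z => SchwartzMap.seminorm ℂ k n (F z)) μ) {G : SchwartzMap E ℂ}
    (hG : ∀ x, G x = ∫ z, F z x ∂μ) (m x : E) :
    (LineDeriv.lineDerivOp m G : SchwartzMap E ℂ) x =
      ∫ z, (LineDeriv.lineDerivOp m (F z) : SchwartzMap E ℂ) x ∂μ := by
  have heval : ∀ y : E, Continuous fun f : SchwartzMap E ℂ => f y := fun y =>
    (BoundedContinuousFunction.evalCLM ℂ y).continuous.comp
      (SchwartzMap.toBoundedContinuousFunctionCLM ℂ E ℂ).continuous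
  have hmeas : ∀ y : E, AEStronglyMeasurable (fun z => F z y) μ := fun y =>
    ((heval y).comp hF).aestronglyMeasurable
  have hder : ∀ (f : SchwartzMap E ℂ) (t : ℝ), HasDerivAt (fun t : ℝ => f (x + t • m))
      ((LineDeriv.lineDerivOp m f : SchwartzMap E ℂ) (x + t • m)) t := fun f t => by
    rw [SchwartzMap.lineDerivOp_apply_eq_fderiv]
    have h1 : HasDerivAt (fun t : ℝ => x + t • m) m t := by
      simpa using ((hasDerivAt_id t).smul_const m).const_add x
    exact (f.differentiableAt.hasFDerivAt.comp_hasDerivAt t h1)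
  have hcont : Continuous fun z => (LineDeriv.lineDerivOp m (F z) : SchwartzMap E ℂ) :=
    (LineDeriv.lineDerivOpCLM ℂ (SchwartzMap E ℂ) m).continuous.comp hF
  have key := hasDerivAt_integral_of_dominated_loc_of_deriv_le (μ := μ) (x₀ := (0 : ℝ))
    (F := fun t z => F z (x + t • m))
    (F' := fun t z => (LineDeriv.lineDerivOp m (F z) : SchwartzMap E ℂ) (x + t • m))
    (bound := fun z => ‖m‖ * SchwartzMap.seminorm ℂ 0 1 (F z))
    (s := Set.univ) Filter.univ_mem
    (Eventually.of_forall fun t => hmeas _)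
    ((h_int 0 0).mono' (hmeas _) (ae_of_all _ fun z => SchwartzMap.norm_le_seminorm ℂ _ _))
    ((heval _).comp hcont).aestronglyMeasurable
    (ae_of_all _ fun z t _ => (SchwartzMap.norm_le_seminorm ℂ _ _).trans
      (seminorm_lineDerivOp_le 0 0 m (F z)))
    ((h_int 0 1).const_mul _)
    (ae_of_all _ fun z t _ => hder (F z) t)
  have h2 := hder G 0
  simp_rw [hG] at h2
  simpa using h2.unique key.2

lemma iteratedFDeriv_apply_integral {n : ℕ} {F : Z → SchwartzMap E ℂ} (hF : Continuous F)
    (h_int : ∀ k n, Integrable (fun z => SchwartzMap.seminorm ℂ k n (F z)) μ) {G : SchwartzMap E ℂ}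
    (hG : ∀ x, G x = ∫ z, F z x ∂μ) (x : E) (m : Fin n → E) :
    iteratedFDeriv ℝ n G x m = ∫ z, iteratedFDeriv ℝ n (F z) x m ∂μ := by
  simp_rw [← SchwartzMap.iteratedLineDerivOp_eq_iteratedFDeriv]
  induction n generalizing F G with
  | zero => simpa using hG x
  | succ n ih =>
    simp_rw [LineDeriv.iteratedLineDerivOp_succ_right]
    refine ih ((LineDeriv.lineDerivOpCLM ℂ (SchwartzMap E ℂ) (m (Fin.last n))).continuous.comp hF)
      (fun k j => ?_) (lineDerivOp_apply_integral hF h_int hG _) _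
    have hc : Continuous fun z =>
        (LineDeriv.lineDerivOp (m (Fin.last n)) (F z) : SchwartzMap E ℂ) :=
      (LineDeriv.lineDerivOpCLM ℂ (SchwartzMap E ℂ) (m (Fin.last n))).continuous.comp hF
    refine ((h_int k (j + 1)).const_mul ‖m (Fin.last n)‖).mono'
      (((schwartz_withSeminorms ℂ E ℂ).continuous_seminorm (k, j)).comp hc).aestronglyMeasurable
      (ae_of_all _ fun z => ?_)
    rw [Real.norm_of_nonneg (apply_nonneg _ _)]
    exact seminorm_lineDerivOp_le k j _ _

/-- A continuous linear functional on the Schwartz space commutes with absolutely convergent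
integrals of continuous families. -/
theorem tempered_apply_integral [SecondCountableTopology Z] (u : SchwartzMap E ℂ →L[ℂ] ℂ)
    {F : Z → SchwartzMap E ℂ}
    (hF : Continuous F)
    (h_int : ∀ k n, Integrable (fun z => SchwartzMap.seminorm ℂ k n (F z)) μ) {G : SchwartzMap E ℂ}
    (hG : ∀ x, G x = ∫ z, F z x ∂μ) : u G = ∫ z, u (F z) ∂μ := by
  obtain ⟨s, C, -, hC⟩ := Seminorm.bound_of_continuous (schwartz_withSeminorms ℂ E ℂ)
    ((normSeminorm ℂ ℂ).comp (u : SchwartzMap E ℂ →ₗ[ℂ] ℂ)) (by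
      exact continuous_norm.comp u.continuous)
  let T : SchwartzMap E ℂ →L[ℂ]
      (∀ i : s, BoundedContinuousFunction (PointDirs E i.1.2) ℂ) :=
    ContinuousLinearMap.pi fun i => weightedDeriv E i.1.1 i.1.2
  let T' : SchwartzMap E ℂ →ₗ[ℂ]
      (∀ i : s, BoundedContinuousFunction (PointDirs E i.1.2) ℂ) := T
  have hbd : ∀ f, ‖u f‖ ≤ C * ‖T f‖ := fun f => by
    have h1 := hC f
    refine h1.trans ?_
    rw [_root_.smul_apply, NNReal.smul_def, smul_eq_mul]
    gcongr
    refine Seminorm.finset_sup_apply_le (norm_nonneg _) fun i hi => ?_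
    exact (seminorm_le_norm_weightedDeriv i.1 i.2 f).trans (norm_le_pi_norm (T f) ⟨i, hi⟩)
  have hker : LinearMap.ker T' ≤
      LinearMap.ker (u : SchwartzMap E ℂ →ₗ[ℂ] ℂ) := fun f hf => by
    have h0 : T f = 0 := hf
    have := hbd f
    simpa [h0] using this
  let l : LinearMap.range T' →ₗ[ℂ] ℂ :=
    (Submodule.liftQ _ (u : SchwartzMap E ℂ →ₗ[ℂ] ℂ) hker).comp
      (T'.quotKerEquivRange.symm : _ →ₗ[ℂ] _)
  have hl : ∀ f, l ⟨T f, f, rfl⟩ = u f := fun f => by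
    have : T'.quotKerEquivRange.symm ⟨T f, f, rfl⟩ =
        Submodule.Quotient.mk f :=
      (LinearEquiv.symm_apply_eq _).2 rfl
    simp only [l, LinearMap.comp_apply, LinearEquiv.coe_coe, this]
    rfl
  obtain ⟨L, hL, -⟩ := exists_extension_norm_eq _ (l.mkContinuous C (by
    rintro ⟨-, f, rfl⟩
    exact (congrArg norm (hl f)).le.trans (hbd f)))
  have hLT : ∀ f, L (T f) = u f := fun f => (hL ⟨T f, f, rfl⟩).trans (hl f)
  have hTint : Integrable (fun z => T (F z)) μ :=
    Integrable.of_eval fun i => integrable_weightedDeriv hF h_int i.1.1 i.1.2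
  have hTG : T G = ∫ z, T (F z) ∂μ := by
    ext i p
    let ev : (∀ i : s, BoundedContinuousFunction (PointDirs E i.1.2) ℂ) →L[ℂ] ℂ :=
      (BoundedContinuousFunction.evalCLM ℂ p).comp (ContinuousLinearMap.proj i)
    have h := ev.integral_comp_comm hTint
    refine Eq.trans ?_ h
    change weightedDeriv E i.1.1 i.1.2 G p = ∫ z, weightedDeriv E i.1.1 i.1.2 (F z) p ∂μ
    simp_rw [weightedDeriv_apply]
    rw [integral_const_mul, iteratedFDeriv_apply_integral hF h_int hG]
  rw [← hLT, hTG, ← L.integral_comp_comm hTint]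
  simp_rw [hLT]

end Exchange

lemma norm_pow_le_sub_add {E : Type*} [NormedAddCommGroup E] (t x : E) (k : ℕ) :
    ‖t‖ ^ k ≤ 2 ^ k * (‖t - x‖ ^ k + ‖x‖ ^ k) := by
  have h : ‖t‖ ≤ ‖t - x‖ + ‖x‖ := by simpa using norm_add_le (t - x) x
  calc ‖t‖ ^ k ≤ (‖t - x‖ + ‖x‖) ^ k := by gcongr
    _ ≤ 2 ^ (k - 1) * (‖t - x‖ ^ k + ‖x‖ ^ k) := add_pow_le (norm_nonneg _) (norm_nonneg _) k
    _ ≤ _ := by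
      gcongr
      · norm_num
      · omega

section Translation

variable {E : Type*} [NormedAddCommGroup E] [NormedSpace ℝ E]

lemma iteratedFDeriv_compSubConstCLM (f : SchwartzMap E ℂ) (x t : E) (n : ℕ) :
    iteratedFDeriv ℝ n (SchwartzMap.compSubConstCLM ℂ x f) t = iteratedFDeriv ℝ n f (t - x) := by
  have : ⇑(SchwartzMap.compSubConstCLM ℂ x f) = fun t => f (t - x) := by
    ext t; simp
  rw [this, iteratedFDeriv_comp_sub]

lemma seminorm_compSubConstCLM_le (k n : ℕ) (x : E) (f : SchwartzMap E ℂ) :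
    SchwartzMap.seminorm ℂ k n (SchwartzMap.compSubConstCLM ℂ x f) ≤
      2 ^ k * (SchwartzMap.seminorm ℂ k n f + ‖x‖ ^ k * SchwartzMap.seminorm ℂ 0 n f) := by
  refine SchwartzMap.seminorm_le_bound ℂ k n _ (by positivity) fun t => ?_
  rw [iteratedFDeriv_compSubConstCLM]
  have h1 := SchwartzMap.le_seminorm ℂ k n f (t - x)
  have h2 := SchwartzMap.le_seminorm ℂ 0 n f (t - x)
  rw [pow_zero, one_mul] at h2
  calc _ ≤ 2 ^ k * (‖t - x‖ ^ k + ‖x‖ ^ k) * ‖iteratedFDeriv ℝ n f (t - x)‖ := by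
        gcongr; exact norm_pow_le_sub_add t x k
    _ = 2 ^ k * (‖t - x‖ ^ k * ‖iteratedFDeriv ℝ n f (t - x)‖ +
          ‖x‖ ^ k * ‖iteratedFDeriv ℝ n f (t - x)‖) := by ring
    _ ≤ _ := by gcongr

lemma seminorm_compSubConstCLM_sub_le (k n : ℕ) (x : E) (f : SchwartzMap E ℂ) :
    SchwartzMap.seminorm ℂ k n (SchwartzMap.compSubConstCLM ℂ x f - f) ≤
      2 ^ k * (SchwartzMap.seminorm ℂ k (n + 1) f +
        ‖x‖ ^ k * SchwartzMap.seminorm ℂ 0 (n + 1) f) * ‖x‖ := by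
  refine SchwartzMap.seminorm_le_bound ℂ k n _ (by positivity) fun t => ?_
  have hsub : iteratedFDeriv ℝ n (SchwartzMap.compSubConstCLM ℂ x f - f : SchwartzMap E ℂ) t =
      iteratedFDeriv ℝ n f (t - x) - iteratedFDeriv ℝ n f t := by
    rw [← iteratedFDeriv_compSubConstCLM]
    exact iteratedFDeriv_sub_apply ((SchwartzMap.smooth _ n).contDiffAt)
      ((f.smooth n).contDiffAt)
  have hd : Differentiable ℝ (iteratedFDeriv ℝ n f) :=
    (f.smooth ⊤).differentiable_iteratedFDeriv (by exact_mod_cast ENat.natCast_lt_top n)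
  have hmv := (convex_segment t (t - x)).norm_image_sub_le_of_norm_fderiv_le (𝕜 := ℝ)
    (f := fun y => ‖t‖ ^ k • iteratedFDeriv ℝ n f y)
    (C := 2 ^ k * (SchwartzMap.seminorm ℂ k (n + 1) f +
        ‖x‖ ^ k * SchwartzMap.seminorm ℂ 0 (n + 1) f))
    (fun y _ => (hd y).fun_const_smul _) (fun y hy => ?_) (left_mem_segment ℝ t (t - x))
    (right_mem_segment ℝ t (t - x))
  · rw [hsub]
    rw [← smul_sub, norm_smul, norm_pow, norm_norm] at hmv
    simpa using hmv
  · rw [segment_eq_image'] at hy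
    obtain ⟨θ, ⟨h0, h1⟩, rfl⟩ := hy
    rw [fderiv_fun_const_smul (hd _), norm_smul, norm_pow, norm_norm, norm_fderiv_iteratedFDeriv]
    have := SchwartzMap.le_seminorm ℂ k (n + 1) (SchwartzMap.compSubConstCLM ℂ (θ • x) f) t
    rw [iteratedFDeriv_compSubConstCLM] at this
    have h3 : t + θ • (t - x - t) = t - θ • x := by simp [sub_eq_add_neg]
    beta_reduce
    rw [h3]
    refine this.trans ((seminorm_compSubConstCLM_le _ _ _ _).trans ?_)
    gcongr
    rw [norm_smul, Real.norm_of_nonneg h0]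
    exact mul_le_of_le_one_left (norm_nonneg _) h1

lemma continuous_seminorm (k n : ℕ) :
    Continuous (SchwartzMap.seminorm ℂ k n : SchwartzMap E ℂ → ℝ) :=
  (schwartz_withSeminorms ℂ E ℂ).continuous_seminorm (k, n)

/-- Translation of Schwartz functions is jointly continuous. -/
lemma continuous_compSubConstCLM :
    Continuous fun p : E × SchwartzMap E ℂ => SchwartzMap.compSubConstCLM ℂ p.1 p.2 := by
  rw [continuous_iff_continuousAt]
  rintro ⟨x₀, f₀⟩
  refine ((schwartz_withSeminorms ℂ E ℂ).tendsto_nhds _ _).2 ?_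
  rintro ⟨k, n⟩ ε hε
  set P := fun i j => (SchwartzMap.seminorm ℂ i j : Seminorm ℂ (SchwartzMap E ℂ)) with hP
  let B : E × SchwartzMap E ℂ → ℝ := fun p =>
    2 ^ k * (P k n (p.2 - f₀) + ‖p.1‖ ^ k * P 0 n (p.2 - f₀)) +
      2 ^ k * (2 ^ k * (P k (n + 1) f₀ + ‖p.1 - x₀‖ ^ k * P 0 (n + 1) f₀) * ‖p.1 - x₀‖ +
        ‖x₀‖ ^ k * (2 ^ 0 * (P 0 (n + 1) f₀ + ‖p.1 - x₀‖ ^ 0 * P 0 (n + 1) f₀) * ‖p.1 - x₀‖))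
  have hB : Continuous B := by
    have h : ∀ i j, Continuous fun p : E × SchwartzMap E ℂ => P i j (p.2 - f₀) := fun i j =>
      (continuous_seminorm i j).comp (continuous_snd.sub continuous_const)
    exact (continuous_const.mul ((h k n).add ((continuous_fst.norm.pow k).mul (h 0 n)))).add
      (by fun_prop)
  have hB0 : B (x₀, f₀) = 0 := by simp [B]
  filter_upwards [hB.continuousAt.eventually_lt continuousAt_const (by rwa [hB0])] with p hp
  refine lt_of_le_of_lt ?_ hp
  have hdec : SchwartzMap.compSubConstCLM ℂ p.1 p.2 - SchwartzMap.compSubConstCLM ℂ x₀ f₀ =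
      SchwartzMap.compSubConstCLM ℂ p.1 (p.2 - f₀) +
        SchwartzMap.compSubConstCLM ℂ x₀ (SchwartzMap.compSubConstCLM ℂ (p.1 - x₀) f₀ - f₀) := by
    ext t
    simp
  refine (congrArg (P k n) hdec).le.trans ((map_add_le_add _ _ _).trans ?_)
  refine add_le_add (seminorm_compSubConstCLM_le k n _ _)
    ((seminorm_compSubConstCLM_le k n _ _).trans ?_)
  gcongr
  · exact seminorm_compSubConstCLM_sub_le k n _ _
  · exact seminorm_compSubConstCLM_sub_le 0 n _ _

/-- A family of Schwartz functions whose seminorms grow at most polynomially in the weight `ω`. -/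
def TemperateFamily {ι : Type*} (ω : ι → ℝ) (f : ι → SchwartzMap E ℂ) : Prop :=
  ∀ k n : ℕ, ∃ (C : ℝ) (N : ℕ), 0 ≤ C ∧ ∀ i, SchwartzMap.seminorm ℂ k n (f i) ≤ C * ω i ^ N

lemma TemperateFamily.seminorm_le {ι : Type*} {ω : ι → ℝ} {f : ι → SchwartzMap E ℂ}
    (hf : TemperateFamily ω f) (hω : ∀ i, 1 ≤ ω i) {q : Seminorm ℂ (SchwartzMap E ℂ)}
    (hq : Continuous q) : ∃ (C : ℝ) (N : ℕ), 0 ≤ C ∧ ∀ i, q (f i) ≤ C * ω i ^ N := by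
  obtain ⟨s, C, -, hC⟩ := Seminorm.bound_of_continuous (schwartz_withSeminorms ℂ E ℂ) q hq
  have hs : ∃ (C : ℝ) (N : ℕ), 0 ≤ C ∧ ∀ i,
      (s.sup (schwartzSeminormFamily ℂ E ℂ)) (f i) ≤ C * ω i ^ N := by
    clear hC
    induction s using Finset.induction_on with
    | empty => exact ⟨0, 0, le_rfl, fun i => by simp⟩
    | insert a s _ ih =>
      obtain ⟨C₁, N₁, h1, h1'⟩ := ih
      obtain ⟨C₂, N₂, h2, h2'⟩ := hf a.1 a.2
      refine ⟨C₁ + C₂, N₁ + N₂, by positivity, fun i => ?_⟩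
      rw [Finset.sup_insert]
      have e1 : ω i ^ N₁ ≤ ω i ^ (N₁ + N₂) := pow_le_pow_right₀ (hω i) (by omega)
      have e2 : ω i ^ N₂ ≤ ω i ^ (N₁ + N₂) := pow_le_pow_right₀ (hω i) (by omega)
      have e3 : 0 ≤ ω i ^ (N₁ + N₂) := pow_nonneg (zero_le_one.trans (hω i)) _
      refine max_le ((h2' i).trans ?_) ((h1' i).trans ?_)
      · nlinarith [mul_le_mul_of_nonneg_left e2 h2, mul_nonneg h1 e3]
      · nlinarith [mul_le_mul_of_nonneg_left e1 h1, mul_nonneg h2 e3]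
  obtain ⟨C', N, h, h'⟩ := hs
  refine ⟨C * C', N, by positivity, fun i => (hC (f i)).trans ?_⟩
  rw [_root_.smul_apply, NNReal.smul_def, smul_eq_mul, mul_assoc]
  gcongr
  exact h' i

lemma TemperateFamily.norm_apply_le {ι : Type*} {ω : ι → ℝ} {f : ι → SchwartzMap E ℂ}
    (hf : TemperateFamily ω f) (hω : ∀ i, 1 ≤ ω i) (u : SchwartzMap E ℂ →L[ℂ] ℂ) :
    ∃ (C : ℝ) (N : ℕ), 0 ≤ C ∧ ∀ i, ‖u (f i)‖ ≤ C * ω i ^ N :=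
  hf.seminorm_le hω (q := (normSeminorm ℂ ℂ).comp (u : SchwartzMap E ℂ →ₗ[ℂ] ℂ))
    (continuous_norm.comp u.continuous)

lemma TemperateFamily.clm {ι : Type*} {ω : ι → ℝ} {f : ι → SchwartzMap E ℂ}
    (hf : TemperateFamily ω f) (hω : ∀ i, 1 ≤ ω i) (T : SchwartzMap E ℂ →L[ℂ] SchwartzMap E ℂ) :
    TemperateFamily ω fun i => T (f i) := by
  intro k n
  let q : Seminorm ℂ (SchwartzMap E ℂ) :=
    (SchwartzMap.seminorm ℂ k n).comp (T : SchwartzMap E ℂ →ₗ[ℂ] SchwartzMap E ℂ)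
  have hqT : ∀ g, q g = SchwartzMap.seminorm ℂ k n (T g) := fun g => by
    simp [q]
  have hq : Continuous q := by
    have : ⇑q = SchwartzMap.seminorm ℂ k n ∘ T := funext hqT
    rw [this]
    exact (continuous_seminorm k n).comp T.continuous
  simpa only [hqT] using hf.seminorm_le hω hq

lemma TemperateFamily.compSubConstCLM {ι : Type*} {ω : ι → ℝ} {f : ι → SchwartzMap E ℂ}
    (hf : TemperateFamily ω f) (hω : ∀ i, 1 ≤ ω i) {x : ι → E} (hx : ∀ i, ‖x i‖ ≤ ω i) :
    TemperateFamily ω fun i => SchwartzMap.compSubConstCLM ℂ (x i) (f i) := fun k n => by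
  obtain ⟨C₁, N₁, h1, h1'⟩ := hf k n
  obtain ⟨C₂, N₂, h2, h2'⟩ := hf 0 n
  refine ⟨2 ^ k * (C₁ + C₂), N₁ + N₂ + k, by positivity, fun i => ?_⟩
  have hω0 : 0 ≤ ω i := zero_le_one.trans (hω i)
  refine (seminorm_compSubConstCLM_le k n _ _).trans ?_
  have e1 : ω i ^ N₁ ≤ ω i ^ (N₁ + N₂ + k) := pow_le_pow_right₀ (hω i) (by omega)
  have e2 : ω i ^ (k + N₂) ≤ ω i ^ (N₁ + N₂ + k) := pow_le_pow_right₀ (hω i) (by omega)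
  calc _ ≤ 2 ^ k * (C₁ * ω i ^ N₁ + ω i ^ k * (C₂ * ω i ^ N₂)) := by
        gcongr
        · exact h1' i
        · exact hx i
        · exact h2' i
    _ = 2 ^ k * (C₁ * ω i ^ N₁ + C₂ * ω i ^ (k + N₂)) := by ring
    _ ≤ 2 ^ k * (C₁ * ω i ^ (N₁ + N₂ + k) + C₂ * ω i ^ (N₁ + N₂ + k)) := by gcongr
    _ = _ := by ring

lemma temperateFamily_const {ι : Type*} (ω : ι → ℝ) (f : SchwartzMap E ℂ) :
    TemperateFamily ω fun _ : ι => f := fun k n =>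
  ⟨SchwartzMap.seminorm ℂ k n f, 0, apply_nonneg _ _, fun i => by simp⟩

end Translation

section Modulation

open scoped FourierTransform

variable {V : Type*} [NormedAddCommGroup V] [InnerProductSpace ℝ V] [FiniteDimensional ℝ V]
  [MeasurableSpace V] [BorelSpace V]

/-- The time-frequency shift `t ↦ e^{2πi⟨t,q⟩} f (t - x)` of a Schwartz function. -/
def timeFreqShift (f : SchwartzMap V ℂ) (p : V × V) : SchwartzMap V ℂ :=
  𝓕⁻ (SchwartzMap.compSubConstCLM ℂ p.2 (𝓕 (SchwartzMap.compSubConstCLM ℂ p.1 f)))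

lemma timeFreqShift_apply (f : SchwartzMap V ℂ) (p : V × V) (t : V) :
    timeFreqShift f p t = Complex.exp (2 * Real.pi * ⟪t, p.2⟫ * Complex.I) * f (t - p.1) := by
  set g := SchwartzMap.compSubConstCLM ℂ p.1 f with hg
  have h1 : 𝓕⁻ (𝓕 g) t = f (t - p.1) := by
    rw [FourierTransform.fourierInv_fourier_eq, hg]; simp
  rw [← h1, timeFreqShift, ← hg, SchwartzMap.fourierInv_coe, SchwartzMap.fourierInv_coe,
    Real.fourierInv_eq', Real.fourierInv_eq', ← integral_const_mul,
    ← integral_add_right_eq_self _ p.2]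
  congr 1 with v
  simp only [SchwartzMap.compSubConstCLM_apply, add_sub_cancel_right, smul_eq_mul]
  rw [← mul_assoc, ← Complex.exp_add, inner_add_left, real_inner_comm t p.2]
  congr 2
  push_cast
  ring

lemma continuous_timeFreqShift (f : SchwartzMap V ℂ) : Continuous (timeFreqShift f) := by
  have h1 : Continuous fun p : V × V => SchwartzMap.compSubConstCLM ℂ p.1 f :=
    continuous_compSubConstCLM.comp (continuous_fst.prodMk continuous_const)
  have h2 : Continuous fun p : V × V => 𝓕 (SchwartzMap.compSubConstCLM ℂ p.1 f) :=
    (FourierTransform.fourierCLM ℂ (SchwartzMap V ℂ)).continuous.comp h1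
  exact (FourierTransform.fourierInvCLM ℂ (SchwartzMap V ℂ)).continuous.comp
    (continuous_compSubConstCLM.comp (continuous_snd.prodMk h2))

lemma temperateFamily_timeFreqShift (f : SchwartzMap V ℂ) :
    TemperateFamily (fun p : V × V => 1 + ‖p‖) (timeFreqShift f) := by
  have hω : ∀ p : V × V, 1 ≤ 1 + ‖p‖ := fun p => by simp
  have h1 := (temperateFamily_const (fun p : V × V => 1 + ‖p‖) f).compSubConstCLM hω
    (x := Prod.fst) fun p => (norm_fst_le p).trans (by simp)
  have h2 := (h1.clm hω (FourierTransform.fourierCLM ℂ (SchwartzMap V ℂ))).compSubConstCLM hω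
    (x := Prod.snd) fun p => (norm_snd_le p).trans (by simp)
  exact h2.clm hω (FourierTransform.fourierInvCLM ℂ (SchwartzMap V ℂ))

end Modulation

section Coordinates

variable {d : ℕ}

/-- Smooth functions on `ℝ^d`. -/
abbrev SmoothFun (d : ℕ) : Type := {f : Ed d → ℂ // ContDiff ℝ ((⊤ : ℕ∞) : WithTop ℕ∞) f}

lemma contDiff_pdGS {f : Ed d → ℂ} (hf : ContDiff ℝ ((⊤ : ℕ∞) : WithTop ℕ∞) f) (i : Fin d) :
    ContDiff ℝ ((⊤ : ℕ∞) : WithTop ℕ∞) (pdGS i f) :=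
  (hf.fderiv_right (m := ((⊤ : ℕ∞) : WithTop ℕ∞)) (by simp)).clm_apply contDiff_const

lemma pdGS_comm {f : Ed d → ℂ} (hf : ContDiff ℝ ((⊤ : ℕ∞) : WithTop ℕ∞) f) (i j : Fin d) :
    pdGS i (pdGS j f) = pdGS j (pdGS i f) := by
  have hd : Differentiable ℝ (fderiv ℝ f) :=
    (hf.fderiv_right (m := ((⊤ : ℕ∞) : WithTop ℕ∞)) (by simp)).differentiable (by simp)
  have key : ∀ (a b : Fin d) (x : Ed d), pdGS a (pdGS b f) x =
      fderiv ℝ (fderiv ℝ f) x (EuclideanSpace.single a 1) (EuclideanSpace.single b 1) :=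
    fun a b x => by
      change fderiv ℝ (fun y => fderiv ℝ f y (EuclideanSpace.single b 1)) x _ = _
      rw [fderiv_clm_apply (hd x) (differentiableAt_const _)]
      simp
  ext x
  rw [key, key]
  exact ContDiffAt.isSymmSndFDerivAt (n := ((⊤ : ℕ∞) : WithTop ℕ∞)) hf.contDiffAt
    (by
      rw [minSmoothness_of_isRCLikeNormedField]
      exact WithTop.coe_le_coe.2 (le_top : (2 : ℕ∞) ≤ ⊤)) _ _

/-- The partial derivative as an operator on smooth functions. -/
def pdSmooth (i : Fin d) (f : SmoothFun d) : SmoothFun d := ⟨pdGS i f.1, contDiff_pdGS f.2 i⟩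

lemma coe_foldr_pdSmooth (L : List (Fin d)) (f : SmoothFun d) :
    (L.foldr pdSmooth f).1 = L.foldr pdGS f.1 := by
  induction L with
  | nil => rfl
  | cons a L ih => simp only [List.foldr_cons, ← ih]; rfl

lemma foldr_pdGS_perm {f : Ed d → ℂ} (hf : ContDiff ℝ ((⊤ : ℕ∞) : WithTop ℕ∞) f)
    {L L' : List (Fin d)} (h : L.Perm L') : L.foldr pdGS f = L'.foldr pdGS f := by
  rw [← coe_foldr_pdSmooth L ⟨f, hf⟩, ← coe_foldr_pdSmooth L' ⟨f, hf⟩,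
    h.foldr_eq' fun i _ j _ g => Subtype.ext (pdGS_comm g.2 j i)]

/-- The list of coordinate indices in which `i` occurs `β i` times. -/
def indexList (β : Fin d → ℕ) : List (Fin d) :=
  (List.finRange d).flatMap fun i => List.replicate (β i) i

lemma foldr_replicate_pdGS (n : ℕ) (i : Fin d) (f : Ed d → ℂ) :
    (List.replicate n i).foldr pdGS f = (pdGS i)^[n] f := by
  induction n with
  | zero => rfl
  | succ n ih => rw [List.replicate_succ, List.foldr_cons, ih, Function.iterate_succ_apply']

lemma mderiv_eq_foldr (β : Fin d → ℕ) (f : Ed d → ℂ) :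
    mderiv β f = (indexList β).foldr pdGS f := by
  rw [mderiv, List.ofFn_eq_map, indexList]
  induction List.finRange d with
  | nil => rfl
  | cons a l ih =>
    rw [List.map_cons, List.foldr_cons, List.flatMap_cons, List.foldr_append, ← ih,
      foldr_replicate_pdGS]
    rfl

lemma count_indexList (β : Fin d → ℕ) (j : Fin d) : (indexList β).count j = β j := by
  rw [indexList, List.count_flatMap, ← List.ofFn_eq_map, List.sum_ofFn]
  simp [List.count_replicate]

lemma mderiv_count {f : Ed d → ℂ} (hf : ContDiff ℝ ((⊤ : ℕ∞) : WithTop ℕ∞) f)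
    (L : List (Fin d)) : mderiv (fun i => L.count i) f = L.foldr pdGS f := by
  rw [mderiv_eq_foldr]
  exact foldr_pdGS_perm hf (List.perm_iff_count.2 fun j => count_indexList _ _)

lemma mderiv_single {f : Ed d → ℂ} (hf : ContDiff ℝ ((⊤ : ℕ∞) : WithTop ℕ∞) f) (j : Fin d)
    (n : ℕ) : mderiv (Pi.single j n) f = (pdGS j)^[n] f := by
  rw [← foldr_replicate_pdGS, ← mderiv_count hf]
  congr 1
  ext i
  by_cases h : i = j
  · subst h; simp
  · simp [h, List.count_replicate, Ne.symm h]

lemma iteratedFDeriv_single_eq {f : Ed d → ℂ} (hf : ContDiff ℝ ((⊤ : ℕ∞) : WithTop ℕ∞) f) {n : ℕ}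
    (σ : Fin n → Fin d) (x : Ed d) :
    iteratedFDeriv ℝ n f x (fun i => EuclideanSpace.single (σ i) 1) =
      (List.ofFn σ).foldr pdGS f x := by
  induction n generalizing x with
  | zero => simp
  | succ n ih =>
    rw [iteratedFDeriv_succ_apply_left, List.ofFn_succ, List.foldr_cons]
    have hd : Differentiable ℝ (iteratedFDeriv ℝ n f) :=
      hf.differentiable_iteratedFDeriv (by exact_mod_cast ENat.natCast_lt_top n)
    have h1 : (List.ofFn fun i => σ i.succ).foldr pdGS f =
        fun y => iteratedFDeriv ℝ n f y fun i => EuclideanSpace.single (σ i.succ) 1 :=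
      funext fun y => (ih (fun i => σ i.succ) y).symm
    rw [h1, pdGS]
    have := (((ContinuousMultilinearMap.apply ℝ (fun _ : Fin n => Ed d) ℂ
      (fun i => EuclideanSpace.single (σ i.succ) 1)).hasFDerivAt).comp x
      (hd x).hasFDerivAt).fderiv
    simp only [Function.comp_def, ContinuousMultilinearMap.apply_apply] at this
    rw [this]
    rfl

lemma norm_le_sum_single {n : ℕ} (D : ContinuousMultilinearMap ℝ (fun _ : Fin n => Ed d) ℂ) :
    ‖D‖ ≤ ∑ σ : Fin n → Fin d, ‖D fun i => EuclideanSpace.single (σ i) 1‖ := by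
  refine ContinuousMultilinearMap.opNorm_le_bound (Finset.sum_nonneg fun _ _ => norm_nonneg _)
    fun m => ?_
  have hm : m = fun i => ∑ j, m i j • (EuclideanSpace.single j 1 : Ed d) := by
    funext i
    ext j
    simp [Finset.sum_apply, Pi.single_apply]
  have h1 : D m = ∑ σ : Fin n → Fin d,
      (∏ i, m i (σ i)) • D fun i => EuclideanSpace.single (σ i) 1 := by
    conv_lhs => rw [hm]
    rw [ContinuousMultilinearMap.map_sum]
    exact Finset.sum_congr rfl fun σ _ => D.map_smul_univ _ _
  rw [h1, Finset.sum_mul]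
  refine (norm_sum_le _ _).trans (Finset.sum_le_sum fun σ _ => ?_)
  rw [norm_smul, norm_prod, mul_comm]
  gcongr
  exact PiLp.norm_apply_le _ _

lemma exists_coord_norm_le [NeZero d] (x : Ed d) : ∃ i, ‖x‖ ≤ d * |x i| := by
  obtain ⟨i, -, hi⟩ := Finset.exists_max_image Finset.univ (fun i => |x i|) Finset.univ_nonempty
  refine ⟨i, ?_⟩
  have hx : x = ∑ j, x j • (EuclideanSpace.single j 1 : Ed d) := by
    ext j
    simp [Finset.sum_apply, Pi.single_apply]
  calc ‖x‖ = ‖∑ j, x j • (EuclideanSpace.single j 1 : Ed d)‖ := congrArg norm hx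
    _ ≤ ∑ j, ‖x j • (EuclideanSpace.single j 1 : Ed d)‖ := norm_sum_le _ _
    _ ≤ ∑ _j : Fin d, |x i| := Finset.sum_le_sum fun j _ => by
        simpa [norm_smul] using hi j (Finset.mem_univ _)
    _ = d * |x i| := by simp

lemma mpow_single (x : Ed d) (i : Fin d) (k : ℕ) : mpow x (Pi.single i k) = x i ^ k := by
  rw [mpow, Finset.prod_eq_single i (fun j _ hj => by simp [hj]) (by simp)]
  simp

lemma mlen_single (i : Fin d) (k : ℕ) : mlen (Pi.single i k) = k := by
  simp [mlen]

lemma mfact_single (i : Fin d) (k : ℕ) : mfact (Pi.single i k) = k.factorial := by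
  rw [mfact, Finset.prod_eq_single i (fun j _ hj => by simp [hj]) (by simp)]
  simp

/-- Pointwise form of the finiteness of a Gelfand–Shilov seminorm. -/
lemma exists_bound_of_GSnorm_lt_top {s h : ℝ} (hh : 0 < h) {f : Ed d → ℂ}
    (hf : GSnorm s h f < ⊤) : ∃ C, 0 ≤ C ∧ ∀ x α β, |mpow x α| * ‖mderiv β f x‖ ≤
      C * (h ^ (mlen α + mlen β) * ((mfact α : ℝ) * (mfact β : ℝ)) ^ s) := by
  refine ⟨(GSnorm s h f).toReal, ENNReal.toReal_nonneg, fun x α β => ?_⟩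
  have hfac : ∀ α : Fin d → ℕ, (0 : ℝ) < mfact α := fun α => by
    rw [mfact]; exact_mod_cast Finset.prod_pos fun i _ => Nat.factorial_pos _
  have hpos : 0 < h ^ (mlen α + mlen β) * ((mfact α : ℝ) * (mfact β : ℝ)) ^ s :=
    mul_pos (pow_pos hh _) (Real.rpow_pos_of_pos (mul_pos (hfac α) (hfac β)) _)
  rw [← div_le_iff₀ hpos, ← ENNReal.ofReal_le_iff_le_toReal hf.ne]
  exact le_iSup_of_le x (le_iSup_of_le α (le_iSup_of_le β le_rfl))

/-- Elements of the Gelfand–Shilov space are Schwartz functions. -/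
lemma exists_schwartzMap_of_mem_SigmaGS [NeZero d] {s : ℝ} {f : Ed d → ℂ} (hf : f ∈ SigmaGS s d) :
    ∃ g : SchwartzMap (Ed d) ℂ, ⇑g = f := by
  refine ⟨⟨f, hf.1, fun k n => ?_⟩, rfl⟩
  obtain ⟨C, hC0, hC⟩ := exists_bound_of_GSnorm_lt_top one_pos (hf.2 1 one_pos)
  refine ⟨∑ σ : Fin n → Fin d, d ^ k * (C * (1 *
    ((k.factorial : ℝ) * (mfact fun i => (List.ofFn σ).count i : ℕ)) ^ s)), fun x => ?_⟩
  obtain ⟨i, hi⟩ := exists_coord_norm_le x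
  calc ‖x‖ ^ k * ‖iteratedFDeriv ℝ n f x‖
      ≤ (d * |x i|) ^ k * ∑ σ : Fin n → Fin d,
        ‖iteratedFDeriv ℝ n f x fun i => EuclideanSpace.single (σ i) 1‖ := by
        gcongr
        exact norm_le_sum_single _
    _ = ∑ σ : Fin n → Fin d, d ^ k * (|mpow x (Pi.single i k)| *
          ‖mderiv (fun i => (List.ofFn σ).count i) f x‖) := by
        rw [Finset.mul_sum]
        refine Finset.sum_congr rfl fun σ _ => ?_
        rw [iteratedFDeriv_single_eq hf.1, mderiv_count hf.1, mpow_single, abs_pow]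
        ring
    _ ≤ _ := by
        refine Finset.sum_le_sum fun σ _ => mul_le_mul_of_nonneg_left ?_ (by positivity)
        simpa [mfact_single] using hC x (Pi.single i k) fun i => (List.ofFn σ).count i

lemma norm_pow_mul_pdGS_le_of_mem_SigmaGS [NeZero d] {s : ℝ} {f : Ed d → ℂ}
    (hf : f ∈ SigmaGS s d) {h : ℝ} (hh : 0 < h) :
    ∃ C, 0 ≤ C ∧ ∀ (k n : ℕ) (j : Fin d) (x : Ed d), ‖x‖ ^ k * ‖(pdGS j)^[n] f x‖ ≤
      C * (h ^ (k + n) * ((k.factorial : ℝ) * (n.factorial : ℝ)) ^ s) := by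
  have hd : (1 : ℝ) ≤ d := by exact_mod_cast Nat.one_le_iff_ne_zero.2 (NeZero.ne d)
  have hd0 : (0 : ℝ) < d := by linarith
  obtain ⟨C, hC0, hC⟩ := exists_bound_of_GSnorm_lt_top (div_pos hh hd0) (hf.2 _ (div_pos hh hd0))
  refine ⟨C, hC0, fun k n j x => ?_⟩
  obtain ⟨i, hi⟩ := exists_coord_norm_le x
  have h1 := hC x (Pi.single i k) (Pi.single j n)
  rw [mpow_single, mderiv_single hf.1, mlen_single, mlen_single, mfact_single, mfact_single,
    abs_pow] at h1
  calc ‖x‖ ^ k * ‖(pdGS j)^[n] f x‖ ≤ (d * |x i|) ^ k * ‖(pdGS j)^[n] f x‖ := by gcongr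
    _ = d ^ k * (|x i| ^ k * ‖(pdGS j)^[n] f x‖) := by ring
    _ ≤ d ^ k * (C * ((h / d) ^ (k + n) * ((k.factorial : ℝ) * (n.factorial : ℝ)) ^ s)) := by
        gcongr
    _ = d ^ k / d ^ (k + n) *
          (C * (h ^ (k + n) * ((k.factorial : ℝ) * (n.factorial : ℝ)) ^ s)) := by
        rw [div_pow]; ring
    _ ≤ 1 * (C * (h ^ (k + n) * ((k.factorial : ℝ) * (n.factorial : ℝ)) ^ s)) := by
        gcongr
        refine div_le_one_of_le₀ ?_ (by positivity)
        exact pow_le_pow_right₀ hd (by omega)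
    _ = _ := one_mul _

end Coordinates

section Moments

open scoped FourierTransform

variable {d : ℕ}

/-- The partial derivative on Schwartz functions. -/
def pdSchwartz (j : Fin d) : SchwartzMap (Ed d) ℂ →L[ℂ] SchwartzMap (Ed d) ℂ :=
  LineDeriv.lineDerivOpCLM ℂ (SchwartzMap (Ed d) ℂ) (EuclideanSpace.single j (1 : ℝ))

lemma coe_pdSchwartz (j : Fin d) (f : SchwartzMap (Ed d) ℂ) : ⇑(pdSchwartz j f) = pdGS j f := by
  ext x
  exact SchwartzMap.lineDerivOp_apply_eq_fderiv (EuclideanSpace.single j (1 : ℝ)) f x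

lemma coe_iterate_pdSchwartz (j : Fin d) (n : ℕ) (f : SchwartzMap (Ed d) ℂ) :
    ⇑((pdSchwartz j)^[n] f) = (pdGS j)^[n] f := by
  induction n generalizing f with
  | zero => rfl
  | succ n ih => rw [Function.iterate_succ_apply, Function.iterate_succ_apply, ih, coe_pdSchwartz]

/-- Gelfand–Shilov decay of a Schwartz function, in terms of pure derivatives and with polynomial
weights. -/
def HasGSDecay (s : ℝ) (f : SchwartzMap (Ed d) ℂ) : Prop :=
  ∀ (M : ℕ) (h : ℝ), 0 < h → ∃ D, 0 ≤ D ∧ ∀ (k n : ℕ) (j : Fin d) (x : Ed d),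
    ‖x‖ ^ k * ‖(pdSchwartz j)^[n] f x‖ * (1 + ‖x‖) ^ M ≤
      D * (h ^ (k + n) * ((k.factorial : ℝ) * (n.factorial : ℝ)) ^ s)

lemma factorial_add_rpow_le {s : ℝ} (hs : 0 < s) (k M : ℕ) : ((k + M).factorial : ℝ) ^ s ≤
    (2 ^ s) ^ (k + M) * ((k.factorial : ℝ) ^ s * (M.factorial : ℝ) ^ s) := by
  have h : ((k + M).factorial : ℝ) ≤ 2 ^ (k + M) * (k.factorial * M.factorial) := by
    have h1 := Nat.add_choose_mul_factorial_mul_factorial k M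
    have h2 := Nat.choose_le_two_pow (k + M) M
    rw [← h1, mul_assoc]
    push_cast
    gcongr
    exact_mod_cast h2
  calc ((k + M).factorial : ℝ) ^ s ≤ (2 ^ (k + M) * (k.factorial * M.factorial)) ^ s := by gcongr
    _ = _ := by
      rw [Real.mul_rpow (by positivity) (by positivity),
        Real.mul_rpow (by positivity) (by positivity), ← Real.rpow_natCast, ← Real.rpow_natCast,
        ← Real.rpow_mul (by norm_num), ← Real.rpow_mul (by norm_num), mul_comm s]

lemma factorial_mul_rpow_le {s : ℝ} (hs : 0 < s) (k m : ℕ) :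
    (k.factorial : ℝ) ^ s * (m.factorial : ℝ) ^ s ≤ ((k + m).factorial : ℝ) ^ s := by
  rw [← Real.mul_rpow (by positivity) (by positivity)]
  gcongr
  exact_mod_cast Nat.le_of_dvd (Nat.factorial_pos _)
    (Nat.factorial_mul_factorial_dvd_factorial_add k m)

lemma hasGSDecay_of_mem_SigmaGS [NeZero d] {s : ℝ} (hs : 0 < s) {f : SchwartzMap (Ed d) ℂ}
    (hf : ⇑f ∈ SigmaGS s d) : HasGSDecay s f := by
  intro M h hh
  have h2 : (1 : ℝ) ≤ 2 ^ s := Real.one_le_rpow (by norm_num) hs.le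
  have h20 : (0 : ℝ) < 2 ^ s := by positivity
  obtain ⟨C, hC0, hC⟩ := norm_pow_mul_pdGS_le_of_mem_SigmaGS hf (div_pos hh h20)
  refine ⟨2 ^ M * (C * (1 + h ^ M * (M.factorial : ℝ) ^ s)), by positivity, fun k n j x => ?_⟩
  rw [coe_iterate_pdSchwartz]
  set b := ‖(pdGS j)^[n] f x‖
  have hb : 0 ≤ b := norm_nonneg _
  have hr : (1 + ‖x‖) ^ M ≤ 2 ^ M * (1 + ‖x‖ ^ M) := by
    calc (1 + ‖x‖) ^ M ≤ 2 ^ (M - 1) * (1 ^ M + ‖x‖ ^ M) :=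
          add_pow_le zero_le_one (norm_nonneg _) M
      _ ≤ _ := by
        rw [one_pow]
        gcongr
        · norm_num
        · omega
  set X := h ^ (k + n) * ((k.factorial : ℝ) * (n.factorial : ℝ)) ^ s with hX
  have e1 : ‖x‖ ^ k * b ≤ C * X := by
    refine (hC k n j x).trans ?_
    rw [hX]
    gcongr
    exact div_le_self hh.le h2
  have e2 : ‖x‖ ^ (k + M) * b ≤ C * (h ^ M * (M.factorial : ℝ) ^ s * X) := by
    refine (hC (k + M) n j x).trans (mul_le_mul_of_nonneg_left ?_ hC0)
    rw [hX, Real.mul_rpow (by positivity) (by positivity),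
      Real.mul_rpow (by positivity) (by positivity)]
    calc (h / 2 ^ s) ^ (k + M + n) * (((k + M).factorial : ℝ) ^ s * (n.factorial : ℝ) ^ s)
        ≤ (h / 2 ^ s) ^ (k + M + n) * ((2 ^ s) ^ (k + M) *
          ((k.factorial : ℝ) ^ s * (M.factorial : ℝ) ^ s) * (n.factorial : ℝ) ^ s) := by
          gcongr
          exact factorial_add_rpow_le hs k M
      _ = (2 ^ s) ^ (k + M) / (2 ^ s) ^ (k + M + n) * (h ^ M * (M.factorial : ℝ) ^ s *
          (h ^ (k + n) * ((k.factorial : ℝ) ^ s * (n.factorial : ℝ) ^ s))) := by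
          rw [div_pow, show k + M + n = M + (k + n) by ring, pow_add h]
          ring
      _ ≤ 1 * _ := by
          gcongr
          exact div_le_one_of_le₀ (pow_le_pow_right₀ h2 (by omega)) (by positivity)
      _ = _ := one_mul _
  calc ‖x‖ ^ k * b * (1 + ‖x‖) ^ M ≤ ‖x‖ ^ k * b * (2 ^ M * (1 + ‖x‖ ^ M)) := by gcongr
    _ = 2 ^ M * (‖x‖ ^ k * b + ‖x‖ ^ (k + M) * b) := by ring
    _ ≤ 2 ^ M * (C * X + C * (h ^ M * (M.factorial : ℝ) ^ s * X)) := by gcongr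
    _ = _ := by ring

lemma pdGS_conj (j : Fin d) (f : Ed d → ℂ) :
    pdGS j (fun x => (starRingEnd ℂ) (f x)) = fun x => (starRingEnd ℂ) (pdGS j f x) := by
  ext x
  have := Complex.conjCLE.comp_fderiv (f := f) (x := x)
  have h2 : (⇑Complex.conjCLE ∘ f) = fun x => (starRingEnd ℂ) (f x) := rfl
  rw [h2] at this
  simp [pdGS, this]

lemma iterate_pdGS_conj (j : Fin d) (n : ℕ) (f : Ed d → ℂ) :
    (pdGS j)^[n] (fun x => (starRingEnd ℂ) (f x)) =
      fun x => (starRingEnd ℂ) ((pdGS j)^[n] f x) := by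
  induction n generalizing f with
  | zero => rfl
  | succ n ih => rw [Function.iterate_succ_apply, pdGS_conj, ih, Function.iterate_succ_apply]

lemma HasGSDecay.conj {s : ℝ} {f g : SchwartzMap (Ed d) ℂ} (hf : HasGSDecay s f)
    (hg : ⇑g = fun x => (starRingEnd ℂ) (f x)) : HasGSDecay s g := by
  have h : ∀ n j x, ‖(pdSchwartz j)^[n] g x‖ = ‖(pdSchwartz j)^[n] f x‖ := fun n j x => by
    rw [coe_iterate_pdSchwartz, coe_iterate_pdSchwartz, hg, iterate_pdGS_conj, RCLike.norm_conj]
  simpa only [HasGSDecay, h] using hf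

lemma exists_schwartzMap_conj (f : SchwartzMap (Ed d) ℂ) :
    ∃ g : SchwartzMap (Ed d) ℂ, ⇑g = fun x => (starRingEnd ℂ) (f x) := by
  refine ⟨⟨fun x => (starRingEnd ℂ) (f x), Complex.conjCLE.contDiff.comp (f.smooth _),
    fun k n => ?_⟩, rfl⟩
  obtain ⟨C, hC⟩ := f.decay k n
  refine ⟨C, fun x => ?_⟩
  have := Complex.conjLIE.norm_iteratedFDeriv_comp_left (f := f) (x := x) n
  have h2 : (⇑Complex.conjLIE ∘ ⇑f) = fun x => (starRingEnd ℂ) (f x) := rfl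
  rw [h2] at this
  rw [this]
  exact hC.2 x

/-- The product of two Schwartz functions. -/
def schwartzMul : SchwartzMap (Ed d) ℂ →ₗ[ℂ] SchwartzMap (Ed d) ℂ →L[ℂ] SchwartzMap (Ed d) ℂ :=
  SchwartzMap.pairing (ContinuousLinearMap.mul ℂ ℂ)

lemma schwartzMul_apply (f g : SchwartzMap (Ed d) ℂ) (x : Ed d) :
    schwartzMul f g x = f x * g x := rfl

lemma pdSchwartz_mul (j : Fin d) (f g : SchwartzMap (Ed d) ℂ) :
    pdSchwartz j (schwartzMul f g) =
      schwartzMul (pdSchwartz j f) g + schwartzMul f (pdSchwartz j g) := by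
  ext x
  rw [_root_.add_apply, schwartzMul_apply, schwartzMul_apply, coe_pdSchwartz, coe_pdSchwartz,
    coe_pdSchwartz]
  have h : ⇑(schwartzMul f g) = fun x => f x * g x := rfl
  rw [h, pdGS, pdGS, pdGS, fderiv_fun_mul f.differentiableAt g.differentiableAt]
  simp
  ring

lemma norm_iterate_pdSchwartz_mul_le {s h : ℝ} (hs : 0 < s) (hh : 0 ≤ h) (j : Fin d) (x : Ed d)
    {a b : ℝ} (ha : 0 ≤ a) (hb : 0 ≤ b) (n p r : ℕ) (f g : SchwartzMap (Ed d) ℂ)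
    (hf : ∀ l, ‖(pdSchwartz j)^[l] f x‖ ≤ a * (h ^ (p + l) * ((p + l).factorial : ℝ) ^ s))
    (hg : ∀ l, ‖(pdSchwartz j)^[l] g x‖ ≤ b * (h ^ (r + l) * ((r + l).factorial : ℝ) ^ s)) :
    ‖(pdSchwartz j)^[n] (schwartzMul f g) x‖ ≤
      2 ^ n * (a * b * (h ^ (p + r + n) * ((p + r + n).factorial : ℝ) ^ s)) := by
  induction n generalizing p r f g with
  | zero =>
    have h1 := hf 0
    have h2 := hg 0
    simp only [Function.iterate_zero, id_eq, add_zero, pow_zero, one_mul] at h1 h2 ⊢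
    rw [schwartzMul_apply, norm_mul]
    calc _ ≤ (a * (h ^ p * (p.factorial : ℝ) ^ s)) * (b * (h ^ r * (r.factorial : ℝ) ^ s)) := by
          gcongr
      _ = a * b * (h ^ (p + r) * ((p.factorial : ℝ) ^ s * (r.factorial : ℝ) ^ s)) := by ring
      _ ≤ _ := by
          gcongr
          exact factorial_mul_rpow_le hs p r
  | succ n ih =>
    rw [Function.iterate_succ_apply, pdSchwartz_mul, iterate_map_add, _root_.add_apply]
    have h1 := ih (p + 1) r (pdSchwartz j f) g
      (fun l => by simpa [add_assoc, add_comm 1 l] using hf (l + 1)) hg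
    have h2 := ih p (r + 1) f (pdSchwartz j g) hf
      (fun l => by simpa [add_assoc, add_comm 1 l] using hg (l + 1))
    rw [show p + 1 + r + n = p + r + (n + 1) by ring] at h1
    rw [show p + (r + 1) + n = p + r + (n + 1) by ring] at h2
    refine (norm_add_le _ _).trans ((add_le_add h1 h2).trans (le_of_eq ?_))
    ring

lemma iterate_pdSchwartz_compSub (j : Fin d) (n : ℕ) (a : Ed d) (f : SchwartzMap (Ed d) ℂ) :
    (pdSchwartz j)^[n] (SchwartzMap.compSubConstCLM ℂ a f) =
      SchwartzMap.compSubConstCLM ℂ a ((pdSchwartz j)^[n] f) := by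
  induction n generalizing f with
  | zero => rfl
  | succ n ih =>
    rw [Function.iterate_succ_apply, Function.iterate_succ_apply, ← ih]
    congr 1
    ext x
    have h : ⇑(SchwartzMap.compSubConstCLM ℂ a f) = fun t => f (t - a) := by ext t; simp
    rw [coe_pdSchwartz, SchwartzMap.compSubConstCLM_apply, coe_pdSchwartz, h, pdGS, pdGS,
      fderiv_comp_sub]

lemma norm_fourier_iterate_pdSchwartz (j : Fin d) (n : ℕ) (f : SchwartzMap (Ed d) ℂ) (q : Ed d) :
    ‖𝓕 ((pdSchwartz j)^[n] f) q‖ = |2 * Real.pi * q j| ^ n * ‖𝓕 f q‖ := by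
  induction n generalizing f with
  | zero => simp
  | succ n ih =>
    have ht : (inner ℝ · (EuclideanSpace.single j (1 : ℝ)) : Ed d → ℝ).HasTemperateGrowth := by
      fun_prop
    rw [Function.iterate_succ_apply, ih]
    have h : 𝓕 (pdSchwartz j f) = (2 * Real.pi * Complex.I) •
        SchwartzMap.smulLeftCLM ℂ (inner ℝ · (EuclideanSpace.single j (1 : ℝ)) : Ed d → ℝ) (𝓕 f) :=
      SchwartzMap.fourier_lineDerivOp_eq f (EuclideanSpace.single j (1 : ℝ))
    rw [h, _root_.smul_apply, SchwartzMap.smulLeftCLM_apply_apply ht]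
    simp [abs_mul, pow_succ, EuclideanSpace.inner_single_right]
    ring

end Moments

section Kernel

open scoped FourierTransform

/-- Moment bounds of Gevrey type give stretched-exponential decay. -/
lemma exp_mul_le_of_moments {s A h a b D : ℝ} (hs : 0 < s) (hA : 0 ≤ A) (hh : 0 ≤ h)
    (hhA : A / s * h ^ (1 / s) ≤ 1 / 2) (ha : 0 ≤ a) (hb : 0 ≤ b) (hD : 0 ≤ D)
    (hmom : ∀ k : ℕ, a ^ k * b ≤ D * (h ^ k * (k.factorial : ℝ) ^ s)) :
    Real.exp (A * a ^ (1 / s)) * b ≤ 2 ^ s * D := by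
  set r := a ^ (1 / s) with hr
  have hr0 : 0 ≤ r := by positivity
  have hss : 1 / s * s = 1 := by field_simp
  have hroot : ∀ k : ℕ, r ^ k * b ^ (1 / s) ≤ D ^ (1 / s) * ((h ^ (1 / s)) ^ k * k.factorial) := by
    intro k
    have h1 := Real.rpow_le_rpow (by positivity) (hmom k) (by positivity : 0 ≤ 1 / s)
    rw [Real.mul_rpow (by positivity) hb, Real.mul_rpow hD (by positivity),
      Real.mul_rpow (by positivity) (by positivity), ← Real.rpow_mul (by positivity),
      mul_comm s, hss, Real.rpow_one] at h1
    have h2 : ∀ x : ℝ, 0 ≤ x → (x ^ k) ^ (1 / s) = (x ^ (1 / s)) ^ k := fun x hx => by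
      rw [← Real.rpow_natCast, ← Real.rpow_natCast, ← Real.rpow_mul hx, ← Real.rpow_mul hx,
        mul_comm]
    rwa [h2 a ha, h2 h hh] at h1
  have hexp : HasSum (fun k : ℕ => (A / s * r) ^ k / k.factorial * b ^ (1 / s))
      (Real.exp (A / s * r) * b ^ (1 / s)) := by
    have := NormedSpace.expSeries_div_hasSum_exp (A / s * r)
    rw [← Real.exp_eq_exp_ℝ] at this
    exact this.mul_right _
  have hgeo : HasSum (fun k : ℕ => D ^ (1 / s) * (1 / 2 : ℝ) ^ k) (D ^ (1 / s) * 2) :=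
    hasSum_geometric_two.mul_left _
  have hle := hasSum_le (fun k => ?_) hexp hgeo
  · have h3 := Real.rpow_le_rpow (by positivity) hle hs.le
    rw [Real.mul_rpow (by positivity) (by positivity),
      Real.mul_rpow (by positivity) (by positivity), ← Real.rpow_mul hb, ← Real.rpow_mul hD, hss,
      Real.rpow_one, Real.rpow_one, ← Real.exp_mul] at h3
    have h4 : A / s * r * s = A * r := by field_simp
    rw [h4] at h3
    linarith
  · have hfac : (0 : ℝ) < k.factorial := by positivity
    calc (A / s * r) ^ k / k.factorial * b ^ (1 / s)
        = (A / s) ^ k / k.factorial * (r ^ k * b ^ (1 / s)) := by rw [mul_pow]; ring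
      _ ≤ (A / s) ^ k / k.factorial * (D ^ (1 / s) * ((h ^ (1 / s)) ^ k * k.factorial)) := by
          exact mul_le_mul_of_nonneg_left (hroot k) (by positivity)
      _ = D ^ (1 / s) * (A / s * h ^ (1 / s)) ^ k := by
          rw [mul_pow]; field_simp
      _ ≤ _ := by gcongr

lemma exists_pos_mul_rpow_le {s A : ℝ} (hs : 0 < s) (hA : 0 < A) (c : ℝ) (hc : 0 < c) :
    ∃ h, 0 < h ∧ A / s * (c * h) ^ (1 / s) ≤ 1 / 2 := by
  refine ⟨(s / (2 * A)) ^ s / c, by positivity, ?_⟩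
  have : c * ((s / (2 * A)) ^ s / c) = (s / (2 * A)) ^ s := by field_simp
  rw [this, ← Real.rpow_mul (by positivity), mul_one_div_cancel hs.ne', Real.rpow_one]
  apply le_of_eq
  field_simp

variable {d : ℕ}

/-- The bilinear pairing of two time-frequency shifted Schwartz functions. -/
def shiftPairing (f g : SchwartzMap (Ed d) ℂ) (p p' : Ed d × Ed d) : ℂ :=
  ∫ t, timeFreqShift f p t * timeFreqShift g p' t

lemma shiftPairing_eq_fourier (f g : SchwartzMap (Ed d) ℂ) (p p' : Ed d × Ed d) :
    shiftPairing f g p p' = 𝓕 (schwartzMul (SchwartzMap.compSubConstCLM ℂ p.1 f)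
      (SchwartzMap.compSubConstCLM ℂ p'.1 g)) (-(p.2 + p'.2)) := by
  rw [shiftPairing, SchwartzMap.fourier_coe, Real.fourier_eq']
  congr 1 with t
  rw [timeFreqShift_apply, timeFreqShift_apply, schwartzMul_apply,
    SchwartzMap.compSubConstCLM_apply, SchwartzMap.compSubConstCLM_apply, smul_eq_mul,
    inner_neg_right, inner_add_right, mul_mul_mul_comm, ← Complex.exp_add]
  congr 2
  push_cast
  ring

lemma norm_fourier_le_integral (f : SchwartzMap (Ed d) ℂ) (q : Ed d) : ‖𝓕 f q‖ ≤ ∫ t, ‖f t‖ := by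
  rw [SchwartzMap.fourier_coe]
  exact VectorFourier.norm_fourierIntegral_le_integral_norm _ _ _ _ _

lemma integrable_one_add_norm_pow_inv (n : ℕ) (hn : d < n) :
    Integrable fun t : Ed d => ((1 + ‖t‖) ^ n)⁻¹ := by
  have := integrable_one_add_norm (E := Ed d) (μ := volume) (r := n) (by simpa using hn)
  refine this.congr (ae_of_all _ fun t => ?_)
  dsimp only
  rw [Real.rpow_neg (by positivity), Real.rpow_natCast]

/-- Off-diagonal decay of the pairing, in the moment form. -/
lemma shiftPairing_moments {s : ℝ} (hs : 0 < s) {f g : SchwartzMap (Ed d) ℂ}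
    (hf : HasGSDecay s f) (hg : HasGSDecay s g) {h : ℝ} (hh : 0 < h) [NeZero d] :
    ∃ D, 0 ≤ D ∧ ∀ p p' : Ed d × Ed d, ∀ k : ℕ,
      ‖p.1 - p'.1‖ ^ k * ‖shiftPairing f g p p'‖ ≤ D * ((2 * h) ^ k * (k.factorial : ℝ) ^ s) ∧
      ∀ j, |2 * Real.pi * (p.2 + p'.2) j| ^ k * ‖shiftPairing f g p p'‖ ≤
        D * ((2 * h) ^ k * (k.factorial : ℝ) ^ s) := by
  obtain ⟨D₁, hD₁, h1⟩ := hf (d + 1) h hh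
  obtain ⟨D₂, hD₂, h2⟩ := hg 0 h hh
  simp only [pow_zero, mul_one] at h2
  have h_int : ∀ a : Ed d, Integrable fun t : Ed d => ((1 + ‖t - a‖) ^ (d + 1))⁻¹ := fun a =>
    (integrable_one_add_norm_pow_inv (d + 1) (by omega)).comp_sub_right a
  set I := ∫ t : Ed d, ((1 + ‖t‖) ^ (d + 1))⁻¹ with hI
  have hI0 : 0 ≤ I := integral_nonneg fun t => by positivity
  have hIa : ∀ a : Ed d, ∫ t : Ed d, ((1 + ‖t - a‖) ^ (d + 1))⁻¹ = I := fun a =>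
    integral_sub_right_eq_self (fun t : Ed d => ((1 + ‖t‖) ^ (d + 1))⁻¹) a
  have hf1 : ∀ (k n : ℕ) (j : Fin d) (x : Ed d), ‖x‖ ^ k * ‖(pdSchwartz j)^[n] f x‖ ≤
      D₁ * ((1 + ‖x‖) ^ (d + 1))⁻¹ *
        (h ^ (k + n) * ((k.factorial : ℝ) * (n.factorial : ℝ)) ^ s) := fun k n j x => by
    have h3 := h1 k n j x
    rw [← le_div_iff₀ (by positivity)] at h3
    refine h3.trans (le_of_eq ?_)
    rw [div_eq_mul_inv]
    ring
  have hsh : ∀ p : Ed d × Ed d, ∀ F : SchwartzMap (Ed d) ℂ, ∀ t,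
      ‖timeFreqShift F p t‖ = ‖F (t - p.1)‖ := fun p F t => by
    rw [timeFreqShift_apply, norm_mul]
    have : (2 * Real.pi * ⟪t, p.2⟫ * Complex.I : ℂ) = ((2 * Real.pi * ⟪t, p.2⟫ : ℝ) : ℂ) *
      Complex.I := by push_cast; ring
    rw [this, Complex.norm_exp_ofReal_mul_I, one_mul]
  have j₀ : Fin d := 0
  refine ⟨2 * D₁ * D₂ * I, by positivity, fun p p' k => ⟨?_, fun j => ?_⟩⟩
  · rw [shiftPairing]
    calc ‖p.1 - p'.1‖ ^ k * ‖∫ t, timeFreqShift f p t * timeFreqShift g p' t‖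
        ≤ ‖p.1 - p'.1‖ ^ k * ∫ t, ‖timeFreqShift f p t * timeFreqShift g p' t‖ := by
          gcongr
          exact norm_integral_le_integral_norm _
      _ = ∫ t, ‖p.1 - p'.1‖ ^ k * (‖f (t - p.1)‖ * ‖g (t - p'.1)‖) := by
          rw [← integral_const_mul]
          simp_rw [norm_mul, hsh]
      _ ≤ ∫ t, 2 ^ k * (2 * D₁ * D₂ * (h ^ k * (k.factorial : ℝ) ^ s)) *
            ((1 + ‖t - p.1‖) ^ (d + 1))⁻¹ := by
          refine integral_mono_of_nonneg (ae_of_all _ fun t => by positivity)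
            ((h_int p.1).const_mul _) (ae_of_all _ fun t => ?_)
          have e1 := hf1 k 0 j₀ (t - p.1)
          have e2 := hf1 0 0 j₀ (t - p.1)
          have e3 := h2 k 0 j₀ (t - p'.1)
          have e4 := h2 0 0 j₀ (t - p'.1)
          simp only [Function.iterate_zero, id_eq, add_zero, pow_zero, one_mul, Nat.factorial_zero,
            Nat.cast_one, mul_one, Real.one_rpow] at e1 e2 e3 e4
          have hn : ‖p.1 - p'.1‖ ^ k ≤ 2 ^ k * (‖t - p'.1‖ ^ k + ‖t - p.1‖ ^ k) := by
            have h5 : ‖p.1 - p'.1‖ ≤ ‖t - p'.1‖ + ‖t - p.1‖ := by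
              calc ‖p.1 - p'.1‖ = ‖(t - p'.1) - (t - p.1)‖ := by congr 1; abel
                _ ≤ _ := norm_sub_le _ _
            calc ‖p.1 - p'.1‖ ^ k ≤ (‖t - p'.1‖ + ‖t - p.1‖) ^ k := by gcongr
              _ ≤ 2 ^ (k - 1) * (‖t - p'.1‖ ^ k + ‖t - p.1‖ ^ k) :=
                add_pow_le (norm_nonneg _) (norm_nonneg _) k
              _ ≤ _ := by
                gcongr
                · norm_num
                · omega
          calc _ ≤ 2 ^ k * (‖t - p'.1‖ ^ k + ‖t - p.1‖ ^ k) *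
                  (‖f (t - p.1)‖ * ‖g (t - p'.1)‖) :=
                mul_le_mul_of_nonneg_right hn (by positivity)
            _ = 2 ^ k * (‖f (t - p.1)‖ * (‖t - p'.1‖ ^ k * ‖g (t - p'.1)‖) +
                  (‖t - p.1‖ ^ k * ‖f (t - p.1)‖) * ‖g (t - p'.1)‖) := by ring
            _ ≤ 2 ^ k * ((D₁ * ((1 + ‖t - p.1‖) ^ (d + 1))⁻¹) *
                  (D₂ * (h ^ k * (k.factorial : ℝ) ^ s)) +
                  (D₁ * ((1 + ‖t - p.1‖) ^ (d + 1))⁻¹ * (h ^ k * (k.factorial : ℝ) ^ s)) *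
                  D₂) := by gcongr
            _ = _ := by ring
      _ = _ := by
          rw [integral_const_mul, hIa, mul_pow]
          ring
  · rw [shiftPairing_eq_fourier]
    set P := schwartzMul (SchwartzMap.compSubConstCLM ℂ p.1 f)
      (SchwartzMap.compSubConstCLM ℂ p'.1 g)
    have h3 := norm_fourier_iterate_pdSchwartz j k P (-(p.2 + p'.2))
    have h4 : |2 * Real.pi * (-(p.2 + p'.2)) j| = |2 * Real.pi * (p.2 + p'.2) j| := by
      rw [← abs_neg]; congr 1; simp; ring
    rw [h4] at h3
    rw [← h3]
    refine (norm_fourier_le_integral _ _).trans ?_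
    calc ∫ t, ‖(pdSchwartz j)^[k] P t‖ ≤ ∫ t, 2 ^ k * (D₁ * D₂ * (h ^ k * (k.factorial : ℝ) ^ s)) *
            ((1 + ‖t - p.1‖) ^ (d + 1))⁻¹ := by
          refine integral_mono_of_nonneg (ae_of_all _ fun t => by positivity)
            ((h_int p.1).const_mul _) (ae_of_all _ fun t => ?_)
          have h5 := norm_iterate_pdSchwartz_mul_le hs hh.le j t
            (a := D₁ * ((1 + ‖t - p.1‖) ^ (d + 1))⁻¹) (b := D₂) (by positivity) hD₂ k 0 0
            (SchwartzMap.compSubConstCLM ℂ p.1 f) (SchwartzMap.compSubConstCLM ℂ p'.1 g)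
            (fun l => by
              rw [iterate_pdSchwartz_compSub, SchwartzMap.compSubConstCLM_apply]
              simpa using hf1 0 l j (t - p.1))
            (fun l => by
              rw [iterate_pdSchwartz_compSub, SchwartzMap.compSubConstCLM_apply]
              simpa using h2 0 l j (t - p'.1))
          refine h5.trans (le_of_eq ?_)
          simp only [zero_add]
          ring
      _ = D₁ * D₂ * I * ((2 * h) ^ k * (k.factorial : ℝ) ^ s) := by
          rw [integral_const_mul, hIa, mul_pow]
          ring
      _ ≤ _ := by
          refine mul_le_mul_of_nonneg_right ?_ (by positivity)
          have : 0 ≤ D₁ * D₂ * I := by positivity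
          linarith

/-- Off-diagonal decay of the pairing of Gelfand–Shilov functions. -/
theorem norm_shiftPairing_le [NeZero d] {s : ℝ} (hs : 0 < s) {f g : SchwartzMap (Ed d) ℂ}
    (hf : HasGSDecay s f) (hg : HasGSDecay s g) {A : ℝ} (hA : 0 < A) :
    ∃ C, 0 ≤ C ∧ ∀ p p' : Ed d × Ed d, ‖shiftPairing f g p p'‖ ≤
      C * Real.exp (-(A * ‖(p.1 - p'.1, (2 * Real.pi) • (p.2 + p'.2))‖ ^ (1 / s))) := by
  have hd : (1 : ℝ) ≤ d := by exact_mod_cast Nat.one_le_iff_ne_zero.2 (NeZero.ne d)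
  set A' := A * (d : ℝ) ^ (1 / s) with hA'
  have hA0 : 0 < A' := by positivity
  have hAA' : A ≤ A' := le_mul_of_one_le_right hA.le (Real.one_le_rpow hd (by positivity))
  obtain ⟨h, hh, hh2⟩ := exists_pos_mul_rpow_le hs hA0 2 two_pos
  obtain ⟨D, hD, hm⟩ := shiftPairing_moments hs hf hg hh
  refine ⟨2 ^ s * D, by positivity, fun p p' => ?_⟩
  set b := ‖shiftPairing f g p p'‖
  rw [Real.exp_neg, ← div_eq_mul_inv, le_div_iff₀ (Real.exp_pos _), mul_comm]
  have key : ∀ a : ℝ, 0 ≤ a → (∀ k : ℕ, a ^ k * b ≤ D * ((2 * h) ^ k * (k.factorial : ℝ) ^ s)) →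
      Real.exp (A' * a ^ (1 / s)) * b ≤ 2 ^ s * D := fun a ha hk =>
    exp_mul_le_of_moments hs hA0.le (by positivity) hh2 ha (norm_nonneg _) hD hk
  rw [Prod.norm_mk]
  rcases max_cases ‖p.1 - p'.1‖ ‖(2 * Real.pi) • (p.2 + p'.2)‖ with ⟨h3, -⟩ | ⟨h3, -⟩
  · rw [h3]
    refine le_trans ?_ (key _ (norm_nonneg _) fun k => (hm p p' k).1)
    gcongr
  · rw [h3]
    obtain ⟨j, hj⟩ := exists_coord_norm_le ((2 * Real.pi) • (p.2 + p'.2))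
    have hj' : ‖(2 * Real.pi) • (p.2 + p'.2)‖ ≤ d * |2 * Real.pi * (p.2 + p'.2) j| := by
      simpa only [PiLp.smul_apply, smul_eq_mul] using hj
    refine le_trans ?_ (key _ (abs_nonneg _) fun k => (hm p p' k).2 j)
    refine mul_le_mul_of_nonneg_right (Real.exp_le_exp.2 ?_) (norm_nonneg _)
    calc A * ‖(2 * Real.pi) • (p.2 + p'.2)‖ ^ (1 / s)
        ≤ A * (d * |2 * Real.pi * (p.2 + p'.2) j|) ^ (1 / s) := by gcongr
      _ = _ := by rw [Real.mul_rpow (by positivity) (by positivity), ← mul_assoc]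

end Kernel

section Cone

lemma add_rpow_le_two_mul {x y t : ℝ} (hx : 0 ≤ x) (hy : 0 ≤ y) (ht : 0 ≤ t) :
    (x + y) ^ t ≤ (2 * x) ^ t + (2 * y) ^ t := by
  rcases le_total x y with h | h
  · have := Real.rpow_le_rpow (by positivity) (by linarith : x + y ≤ 2 * y) ht
    have : 0 ≤ (2 * x) ^ t := by positivity
    linarith
  · have := Real.rpow_le_rpow (by positivity) (by linarith : x + y ≤ 2 * x) ht
    have : 0 ≤ (2 * y) ^ t := by positivity
    linarith

lemma exists_one_add_pow_le_exp {s : ℝ} (hs : 0 < s) (N : ℕ) :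
    ∃ C, 0 ≤ C ∧ ∀ R, 0 ≤ R → (1 + R) ^ N ≤ C * Real.exp (R ^ (1 / s)) := by
  obtain ⟨m, hm⟩ := exists_nat_ge (s * N)
  refine ⟨2 ^ N * (m.factorial * Real.exp 1), by positivity, fun R hR => ?_⟩
  set ρ := R ^ (1 / s) with hρ
  have hρ0 : 0 ≤ ρ := by positivity
  have hR' : R = ρ ^ s := by
    rw [hρ, ← Real.rpow_mul hR, one_div_mul_cancel hs.ne', Real.rpow_one]
  have h1 : 1 + R ≤ 2 * (1 + ρ) ^ s := by
    have h2 : (1 : ℝ) ≤ (1 + ρ) ^ s := Real.one_le_rpow (by linarith) hs.le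
    have h3 : ρ ^ s ≤ (1 + ρ) ^ s := Real.rpow_le_rpow hρ0 (by linarith) hs.le
    linarith
  have h4 : ((1 + ρ) ^ s) ^ N ≤ (1 + ρ) ^ m := by
    rw [← Real.rpow_natCast, ← Real.rpow_natCast, ← Real.rpow_mul (by positivity)]
    exact Real.rpow_le_rpow_of_exponent_le (by linarith) hm
  have h5 := Real.pow_div_factorial_le_exp (1 + ρ) (by positivity) m
  rw [div_le_iff₀ (by positivity), Real.exp_add] at h5
  calc (1 + R) ^ N ≤ (2 * (1 + ρ) ^ s) ^ N := by gcongr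
    _ = 2 ^ N * ((1 + ρ) ^ s) ^ N := mul_pow _ _ _
    _ ≤ 2 ^ N * (Real.exp 1 * Real.exp ρ * m.factorial) := by
        gcongr
        exact h4.trans h5
    _ = _ := by ring

variable {E : Type*} [NormedAddCommGroup E] [NormedSpace ℝ E]

/-- Superexponential decay of order `1 / s` on a set. -/
def SuperexpDecayOn (s : ℝ) (Γ : Set E) (f : E → ℝ) : Prop :=
  ∀ A : ℝ, 0 < A → ∃ C, ∀ z ∈ Γ, Real.exp (A * ‖z‖ ^ (1 / s)) * f z ≤ C

/-- Superexponential decay on a conic neighbourhood of a point. -/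
def SuperexpDecayNear (s : ℝ) (z₀ : E) (f : E → ℝ) : Prop :=
  ∃ Γ : Set E, IsOpen Γ ∧ IsConic Γ ∧ (0 : E) ∉ Γ ∧ z₀ ∈ Γ ∧ SuperexpDecayOn s Γ f

lemma exists_conic_nhd {Γ : Set E} (hΓ : IsOpen Γ) (hc : IsConic Γ) {z₀ : E} (hz₀ : z₀ ≠ 0)
    (hz : z₀ ∈ Γ) : ∃ ε, 0 < ε ∧ ε ≤ 1 / 2 ∧ ∃ Γ' : Set E, IsOpen Γ' ∧ IsConic Γ' ∧
      (0 : E) ∉ Γ' ∧ z₀ ∈ Γ' ∧ ∀ z ∈ Γ', ∀ q, ‖q - z‖ ≤ ε * ‖z‖ → q ∈ Γ := by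
  obtain ⟨δ₀, hδ₀, hball⟩ := Metric.isOpen_iff.1 hΓ z₀ hz
  have hn : 0 < ‖z₀‖ := norm_pos_iff.2 hz₀
  set δ := min (δ₀ / 2) (‖z₀‖ / 2) with hδ
  have hδ0 : 0 < δ := by positivity
  have hδ1 : δ ≤ δ₀ / 2 := min_le_left _ _
  have hδ2 : δ ≤ ‖z₀‖ / 2 := min_le_right _ _
  refine ⟨δ / (2 * ‖z₀‖), by positivity, ?_, {z | ∃ t : ℝ, 0 < t ∧ ‖t • z - z₀‖ < δ}, ?_, ?_, ?_,
    ?_, ?_⟩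
  · rw [div_le_iff₀ (by positivity)]
    linarith
  · simp only [Set.ofPred_exists, Set.ofPred_and]
    refine isOpen_iUnion fun t => isOpen_const.inter (isOpen_lt ?_ continuous_const)
    fun_prop
  · rintro r hr z ⟨t, ht, h⟩
    refine ⟨t / r, by positivity, ?_⟩
    rwa [smul_smul, div_mul_cancel₀ _ hr.ne']
  · rintro ⟨t, -, h⟩
    rw [smul_zero, zero_sub, norm_neg] at h
    linarith
  · exact ⟨1, one_pos, by simpa using hδ0⟩
  · rintro z ⟨t, ht, h⟩ q hq
    have h1 : ‖t • z‖ ≤ 2 * ‖z₀‖ := by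
      have := norm_add_le (t • z - z₀) z₀
      rw [sub_add_cancel] at this
      linarith
    have h2 : ‖t • q - t • z‖ ≤ δ := by
      rw [← smul_sub, norm_smul, Real.norm_of_nonneg ht.le]
      calc t * ‖q - z‖ ≤ t * (δ / (2 * ‖z₀‖) * ‖z‖) := by gcongr
        _ = δ / (2 * ‖z₀‖) * ‖t • z‖ := by rw [norm_smul, Real.norm_of_nonneg ht.le]; ring
        _ ≤ δ / (2 * ‖z₀‖) * (2 * ‖z₀‖) := by gcongr
        _ = δ := by field_simp
    have h3 : t • q ∈ Γ := by
      refine hball ?_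
      rw [mem_ball_iff_norm]
      have := norm_add_le (t • q - t • z) (t • z - z₀)
      rw [sub_add_sub_cancel] at this
      linarith
    have := hc t⁻¹ (by positivity) _ h3
    rwa [inv_smul_smul₀ ht.ne'] at this

variable [FiniteDimensional ℝ E] [MeasurableSpace E] [BorelSpace E]

/-- Integral operators whose kernel decays superexponentially off the graph of `P` propagate
superexponential decay on cones. -/
theorem SuperexpDecayNear.of_integral {s : ℝ} (hs : 0 < s) (μ : Measure E) [μ.IsAddHaarMeasure]
    {f g : E → ℝ} (hf0 : ∀ z, 0 ≤ f z) {C₀ : ℝ} (hC₀ : 0 ≤ C₀) {N : ℕ}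
    (hf : ∀ z, f z ≤ C₀ * (1 + ‖z‖) ^ N) {κ : E → E → ℝ} (hκ0 : ∀ p z, 0 ≤ κ p z)
    {P Q : E → E} {R : E → E → ℝ} {a : ℝ} (ha : 0 ≤ a) (hP : ∀ p z, ‖P p - z‖ ≤ R p z + a)
    (hQ : ∀ p z, ‖p - Q z‖ ≤ R p z)
    (hκ : ∀ A : ℝ, 0 < A → ∃ C, 0 ≤ C ∧ ∀ p z, κ p z ≤ C * Real.exp (-(A * R p z ^ (1 / s))))
    {c : ℝ} (hc : 0 ≤ c) (hg : ∀ z, g z ≤ c * ∫ p, f (P p) * κ p z ∂μ)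
    {z₀ : E} (hz₀ : z₀ ≠ 0) (h : SuperexpDecayNear s z₀ f) : SuperexpDecayNear s z₀ g := by
  obtain ⟨Γ, hΓ, hΓc, -, hzΓ, hdec⟩ := h
  obtain ⟨ε, hε, hε2, Γ', hΓ', hΓc', h0, hz', hsub⟩ := exists_conic_nhd hΓ hΓc hz₀ hzΓ
  refine ⟨Γ', hΓ', hΓc', h0, hz', fun A hA => ?_⟩
  have hR : ∀ p z, 0 ≤ R p z := fun p z => (norm_nonneg _).trans (hQ p z)
  set M := Module.finrank ℝ E + 1 with hM
  have h_int : Integrable (fun p : E => ((1 + ‖p‖) ^ M)⁻¹) μ := by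
    have := integrable_one_add_norm (E := E) (μ := μ) (r := M) (by simp [hM])
    refine this.congr (ae_of_all _ fun t => ?_)
    dsimp only
    rw [Real.rpow_neg (by positivity), Real.rpow_natCast]
  set I := ∫ p : E, ((1 + ‖p‖) ^ M)⁻¹ ∂μ with hI
  suffices H : ∃ C, ∀ z ∈ Γ', ∀ p, Real.exp (A * ‖z‖ ^ (1 / s)) * (f (P p) * κ p z) ≤
      C * ((1 + ‖p - Q z‖) ^ M)⁻¹ by
    obtain ⟨C, hC⟩ := H
    refine ⟨c * (C * I), fun z hz => ?_⟩
    calc Real.exp (A * ‖z‖ ^ (1 / s)) * g z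
        ≤ Real.exp (A * ‖z‖ ^ (1 / s)) * (c * ∫ p, f (P p) * κ p z ∂μ) := by
          gcongr
          exact hg z
      _ = c * ∫ p, Real.exp (A * ‖z‖ ^ (1 / s)) * (f (P p) * κ p z) ∂μ := by
          rw [integral_const_mul]
          ring
      _ ≤ c * ∫ p, C * ((1 + ‖p - Q z‖) ^ M)⁻¹ ∂μ := by
          refine mul_le_mul_of_nonneg_left (integral_mono_of_nonneg (ae_of_all _ fun p => ?_)
            ((h_int.comp_sub_right (Q z)).const_mul _) (ae_of_all _ fun p => hC z hz p)) hc
          have := hf0 (P p)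
          have := hκ0 p z
          positivity
      _ = c * (C * I) := by
          rw [integral_const_mul, hI,
            integral_sub_right_eq_self (fun p : E => ((1 + ‖p‖) ^ M)⁻¹) (Q z)]
  have hpoly : ∀ p z, ((1 + R p z) ^ M)⁻¹ ≤ ((1 + ‖p - Q z‖) ^ M)⁻¹ := fun p z => by
    have := hQ p z
    gcongr
  -- the region where `P p` is close to `z`
  obtain ⟨C₁, hC₁⟩ := hdec (A * 2 ^ (1 / s)) (by positivity)
  obtain ⟨C₂, hC₂0, hC₂⟩ := hκ 1 one_pos
  obtain ⟨B₁, hB₁0, hB₁⟩ := exists_one_add_pow_le_exp hs M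
  -- the region where `P p` is far from `z`
  obtain ⟨C₃, hC₃0, hC₃⟩ := hκ (1 + A * (2 / ε) ^ (1 / s)) (by positivity)
  obtain ⟨B₂, hB₂0, hB₂⟩ := exists_one_add_pow_le_exp hs (N + M)
  set L := (1 + ε⁻¹) * (1 + a) with hL
  have hL1 : 1 ≤ L := by
    have : 0 < ε⁻¹ := by positivity
    nlinarith
  set T := Real.exp (A * (2 * a / ε) ^ (1 / s)) with hT
  have hC₁0 : 0 ≤ C₁ := by
    have := hC₁ z₀ hzΓ
    have h2 := hf0 z₀
    exact le_trans (by positivity) this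
  refine ⟨C₁ * (C₂ * B₁) + T * (C₀ * (2 * L) ^ N * C₃ * B₂), fun z hz p => ?_⟩
  have hr := hR p z
  have hf0p := hf0 (P p)
  have hκ0p := hκ0 p z
  rw [add_mul]
  by_cases hcase : ‖P p - z‖ ≤ ε * ‖z‖
  · have hPΓ := hsub z hz _ hcase
    have hzP : ‖z‖ ≤ 2 * ‖P p‖ := by
      have h1 := norm_sub_norm_le z (P p)
      rw [norm_sub_rev] at h1
      nlinarith [norm_nonneg z]
    have h1 : Real.exp (A * ‖z‖ ^ (1 / s)) * f (P p) ≤ C₁ := by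
      refine le_trans ?_ (hC₁ _ hPΓ)
      gcongr ?_ * _
      rw [Real.exp_le_exp, mul_assoc, ← Real.mul_rpow (by positivity) (by positivity)]
      gcongr
    have h2 : κ p z ≤ C₂ * B₁ * ((1 + R p z) ^ M)⁻¹ := by
      have h3 := hC₂ p z
      have h4 := hB₁ _ hr
      rw [one_mul, Real.exp_neg] at h3
      refine h3.trans ?_
      rw [mul_assoc]
      refine mul_le_mul_of_nonneg_left ?_ hC₂0
      rw [← div_eq_mul_inv, le_div_iff₀ (by positivity), inv_mul_le_iff₀ (by positivity)]
      linarith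
    have h5 : 0 ≤ T * (C₀ * (2 * L) ^ N * C₃ * B₂) * ((1 + ‖p - Q z‖) ^ M)⁻¹ := by positivity
    calc Real.exp (A * ‖z‖ ^ (1 / s)) * (f (P p) * κ p z)
        = (Real.exp (A * ‖z‖ ^ (1 / s)) * f (P p)) * κ p z := by ring
      _ ≤ C₁ * (C₂ * B₁ * ((1 + ‖p - Q z‖) ^ M)⁻¹) := by
          have h6 := hpoly p z
          gcongr
          exact h2.trans (by gcongr)
      _ ≤ _ := by linarith
  · push Not at hcase
    have hRz : ‖z‖ ≤ ε⁻¹ * (R p z + a) := by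
      rw [inv_mul_eq_div, le_div_iff₀ hε]
      linarith [hP p z]
    have h1 : f (P p) ≤ C₀ * (2 * L) ^ N * (1 + R p z) ^ N := by
      refine (hf _).trans ?_
      rw [mul_assoc, ← mul_pow]
      have h2 : ‖P p‖ ≤ ‖z‖ + (R p z + a) := by
        have := norm_add_le (P p - z) z
        rw [sub_add_cancel] at this
        linarith [hP p z]
      have h3 : 1 + ‖P p‖ ≤ 2 * L * (1 + R p z) := by
        have h4 : ‖P p‖ ≤ (1 + ε⁻¹) * (R p z + a) := by linarith
        have h5 : (1 + ε⁻¹) * (R p z + a) ≤ L * (1 + R p z) := by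
          rw [hL, mul_assoc]
          have : 0 < ε⁻¹ := by positivity
          gcongr
          nlinarith
        nlinarith
      gcongr
    have h2 : Real.exp (A * ‖z‖ ^ (1 / s)) * κ p z ≤
        T * (C₃ * B₂ * ((1 + R p z) ^ (N + M))⁻¹) := by
      have h3 : ‖z‖ ^ (1 / s) ≤ (2 / ε) ^ (1 / s) * R p z ^ (1 / s) + (2 * a / ε) ^ (1 / s) := by
        rw [← Real.mul_rpow (by positivity) hr]
        calc ‖z‖ ^ (1 / s) ≤ (ε⁻¹ * R p z + ε⁻¹ * a) ^ (1 / s) := by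
              rw [← mul_add]
              gcongr
          _ ≤ (2 * (ε⁻¹ * R p z)) ^ (1 / s) + (2 * (ε⁻¹ * a)) ^ (1 / s) :=
              add_rpow_le_two_mul (by positivity) (by positivity) (by positivity)
          _ = _ := by congr 2 <;> ring
      have h4 := hB₂ _ hr
      calc Real.exp (A * ‖z‖ ^ (1 / s)) * κ p z
          ≤ Real.exp (A * ((2 / ε) ^ (1 / s) * R p z ^ (1 / s) + (2 * a / ε) ^ (1 / s))) *
            (C₃ * Real.exp (-((1 + A * (2 / ε) ^ (1 / s)) * R p z ^ (1 / s)))) := by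
            gcongr
            exact hC₃ p z
        _ = T * (C₃ * Real.exp (-(R p z ^ (1 / s)))) := by
            rw [mul_left_comm, ← Real.exp_add, mul_left_comm T, hT, ← Real.exp_add]
            congr 2
            ring
        _ ≤ _ := by
            rw [mul_assoc C₃]
            gcongr
            rw [Real.exp_neg, ← div_eq_mul_inv, le_div_iff₀ (by positivity),
              inv_mul_le_iff₀ (by positivity)]
            linarith
    have h5 : 0 ≤ C₁ * (C₂ * B₁) * ((1 + ‖p - Q z‖) ^ M)⁻¹ := by positivity
    calc Real.exp (A * ‖z‖ ^ (1 / s)) * (f (P p) * κ p z)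
        = f (P p) * (Real.exp (A * ‖z‖ ^ (1 / s)) * κ p z) := by ring
      _ ≤ (C₀ * (2 * L) ^ N * (1 + R p z) ^ N) *
          (T * (C₃ * B₂ * ((1 + R p z) ^ (N + M))⁻¹)) := by gcongr
      _ = T * (C₀ * (2 * L) ^ N * C₃ * B₂) * ((1 + R p z) ^ M)⁻¹ := by
          rw [pow_add]
          field_simp
      _ ≤ T * (C₀ * (2 * L) ^ N * C₃ * B₂) * ((1 + ‖p - Q z‖) ^ M)⁻¹ := by
          have h6 := hpoly p z
          gcongr
      _ ≤ _ := by linarith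

end Cone

section WindowChange

open scoped FourierTransform

variable {d : ℕ}

instance : (volume : Measure (Ed d × Ed d)).IsAddHaarMeasure :=
  Measure.prod.instIsAddHaarMeasure volume volume

lemma shiftPairing_eq_fourierInv (f g : SchwartzMap (Ed d) ℂ) (p p' : Ed d × Ed d) :
    shiftPairing f g p p' =
      𝓕⁻ (schwartzMul (SchwartzMap.compSubConstCLM ℂ p.1 f) (timeFreqShift g p')) p.2 := by
  rw [shiftPairing, SchwartzMap.fourierInv_coe, Real.fourierInv_eq']
  congr 1 with t
  rw [timeFreqShift_apply f, schwartzMul_apply, SchwartzMap.compSubConstCLM_apply, smul_eq_mul,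
    ← mul_assoc]
  congr 3
  push_cast
  ring

lemma continuous_shiftPairing (f g : SchwartzMap (Ed d) ℂ) (p' : Ed d × Ed d) :
    Continuous fun p => shiftPairing f g p p' := by
  have h : (fun p => shiftPairing f g p p') = fun p => SchwartzMap.integralCLM ℂ volume
      (schwartzMul (timeFreqShift g p') (timeFreqShift f p)) := by
    ext p
    rw [SchwartzMap.integralCLM_apply, shiftPairing]
    congr 1 with t
    rw [schwartzMul_apply, mul_comm]
  rw [h]
  exact (SchwartzMap.integralCLM ℂ volume).continuous.comp
    ((schwartzMul (timeFreqShift g p')).continuous.comp (continuous_timeFreqShift f))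

/-- Inversion of the short-time Fourier transform. -/
lemma integral_shiftPairing_mul (f fc g : SchwartzMap (Ed d) ℂ)
    (hfc : ⇑fc = fun x => (starRingEnd ℂ) (f x)) (p' : Ed d × Ed d) (t : Ed d)
    (h_int : Integrable fun p : Ed d × Ed d =>
      shiftPairing f g p p' * timeFreqShift fc (p.1, -p.2) t) :
    ∫ p : Ed d × Ed d, shiftPairing f g p p' * timeFreqShift fc (p.1, -p.2) t =
      ((∫ x, ‖f x‖ ^ 2 : ℝ) : ℂ) * timeFreqShift g p' t := by
  rw [Measure.volume_eq_prod] at h_int ⊢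
  rw [integral_prod _ h_int]
  have hin : ∀ x : Ed d, ∫ q : Ed d, shiftPairing f g (x, q) p' * timeFreqShift fc (x, -q) t =
      ((‖f (t - x)‖ ^ 2 : ℝ) : ℂ) * timeFreqShift g p' t := fun x => by
    set H := schwartzMul (SchwartzMap.compSubConstCLM ℂ x f) (timeFreqShift g p') with hH
    have h1 : ∀ q : Ed d, shiftPairing f g (x, q) p' * timeFreqShift fc (x, -q) t =
        fc (t - x) * (Complex.exp (((-2 * Real.pi * ⟪q, t⟫ : ℝ) : ℂ) * Complex.I) • 𝓕⁻ H q) :=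
      fun q => by
        rw [shiftPairing_eq_fourierInv, timeFreqShift_apply fc, inner_neg_right,
          real_inner_comm, smul_eq_mul]
        push_cast
        rw [show -2 * (Real.pi : ℂ) * (⟪q, t⟫ : ℝ) * Complex.I =
          2 * Real.pi * -(⟪q, t⟫ : ℝ) * Complex.I by ring]
        ring
    simp_rw [h1]
    rw [integral_const_mul, ← Real.fourier_eq', ← SchwartzMap.fourier_coe,
      FourierTransform.fourier_fourierInv_eq, hH, schwartzMul_apply,
      SchwartzMap.compSubConstCLM_apply, hfc, ← mul_assoc]
    congr 1
    rw [← Complex.normSq_eq_conj_mul_self, Complex.normSq_eq_norm_sq]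
  simp_rw [hin]
  rw [integral_mul_const, integral_complex_ofReal,
    integral_sub_left_eq_self (fun x => ‖f x‖ ^ 2) volume t]

lemma norm_sub_neg_le (p p' : Ed d × Ed d) :
    ‖p - (p'.1, -p'.2)‖ ≤ ‖(p.1 - p'.1, (2 * Real.pi) • (p.2 + p'.2))‖ := by
  rw [Prod.norm_def, Prod.norm_mk]
  refine max_le_max le_rfl ?_
  rw [Prod.snd_sub, sub_neg_eq_add, norm_smul, Real.norm_of_nonneg (by positivity)]
  exact le_mul_of_one_le_left (norm_nonneg _) (by linarith [Real.two_le_pi])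

lemma temperateFamily_timeFreqShift_neg (f : SchwartzMap (Ed d) ℂ) :
    TemperateFamily (fun p : Ed d × Ed d => 1 + ‖p‖) fun p => timeFreqShift f (p.1, -p.2) :=
  fun k n => by
    obtain ⟨C, N, hC, h⟩ := temperateFamily_timeFreqShift f k n
    refine ⟨C, N, hC, fun p => (h (p.1, -p.2)).trans (le_of_eq ?_)⟩
    simp [Prod.norm_def]

lemma integrable_norm_shiftPairing_mul [NeZero d] {s : ℝ} (hs : 0 < s)
    {f g : SchwartzMap (Ed d) ℂ} (hf : HasGSDecay s f) (hg : HasGSDecay s g) (p' : Ed d × Ed d)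
    {b : Ed d × Ed d → ℝ} (hb : Continuous b) (hb0 : ∀ p, 0 ≤ b p) {C : ℝ} {N : ℕ} (hC : 0 ≤ C)
    (hbC : ∀ p, b p ≤ C * (1 + ‖p‖) ^ N) :
    Integrable fun p => ‖shiftPairing f g p p'‖ * b p := by
  obtain ⟨C₁, hC₁, h1⟩ := norm_shiftPairing_le hs hf hg one_pos
  set M := Module.finrank ℝ (Ed d × Ed d) + 1 with hM
  obtain ⟨B, hB, h2⟩ := exists_one_add_pow_le_exp hs (N + M)
  set p₀ : Ed d × Ed d := (p'.1, -p'.2) with hp₀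
  have h_int : Integrable fun p : Ed d × Ed d => ((1 + ‖p - p₀‖) ^ M)⁻¹ := by
    have := integrable_one_add_norm (E := Ed d × Ed d) (μ := volume) (r := M)
      (by rw [hM]; push_cast; linarith)
    refine (this.congr (ae_of_all _ fun t => ?_)).comp_sub_right p₀
      (f := fun p : Ed d × Ed d => ((1 + ‖p‖) ^ M)⁻¹)
    dsimp only
    rw [Real.rpow_neg (by positivity), Real.rpow_natCast]
  refine (h_int.const_mul (C₁ * B * (C * (1 + ‖p₀‖) ^ N))).mono'
    ((continuous_shiftPairing f g p').norm.mul hb).aestronglyMeasurable (ae_of_all _ fun p => ?_)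
  have hbp := hb0 p
  rw [Real.norm_of_nonneg (by positivity)]
  set R := ‖(p.1 - p'.1, (2 * Real.pi) • (p.2 + p'.2))‖ with hR
  set r := ‖p - p₀‖ with hr
  have hrR : r ≤ R := norm_sub_neg_le p p'
  have hr0 : 0 ≤ r := norm_nonneg _
  have h3 := h1 p p'
  have h4 : Real.exp (-(1 * R ^ (1 / s))) ≤ B * ((1 + r) ^ (N + M))⁻¹ := by
    rw [one_mul, Real.exp_neg, ← div_eq_mul_inv, le_div_iff₀ (by positivity),
      inv_mul_le_iff₀ (by positivity), mul_comm]
    refine (h2 r hr0).trans ?_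
    gcongr
  have h5 : 1 + ‖p‖ ≤ (1 + ‖p₀‖) * (1 + r) := by
    have := norm_add_le (p - p₀) p₀
    rw [sub_add_cancel] at this
    nlinarith [norm_nonneg p₀]
  calc ‖shiftPairing f g p p'‖ * b p
      ≤ C₁ * (B * ((1 + r) ^ (N + M))⁻¹) * (C * ((1 + ‖p₀‖) * (1 + r)) ^ N) := by
        refine mul_le_mul (h3.trans (by gcongr)) ((hbC p).trans (by gcongr)) hbp (by positivity)
    _ = _ := by
        rw [mul_pow, pow_add]
        field_simp

/-- Change of window, as a pointwise estimate. -/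
lemma norm_apply_timeFreqShift_le [NeZero d] {s : ℝ} (hs : 0 < s) (u : TD d)
    {f fc g : SchwartzMap (Ed d) ℂ} (hf : HasGSDecay s f) (hg : HasGSDecay s g)
    (hfc : ⇑fc = fun x => (starRingEnd ℂ) (f x)) (p' : Ed d × Ed d) :
    (∫ x, ‖f x‖ ^ 2) * ‖u (timeFreqShift g p')‖ ≤
      ∫ p : Ed d × Ed d, ‖u (timeFreqShift fc (p.1, -p.2))‖ * ‖shiftPairing f g p p'‖ := by
  have hcont : Continuous fun p : Ed d × Ed d => timeFreqShift fc (p.1, -p.2) :=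
    (continuous_timeFreqShift fc).comp (continuous_fst.prodMk continuous_snd.neg)
  set F : Ed d × Ed d → SchwartzMap (Ed d) ℂ := fun p =>
    shiftPairing f g p p' • timeFreqShift fc (p.1, -p.2) with hF
  have hFc : Continuous F := (continuous_shiftPairing f g p').smul hcont
  have hFint : ∀ k n, Integrable fun p => SchwartzMap.seminorm ℂ k n (F p) := fun k n => by
    obtain ⟨C, N, hC, h⟩ := temperateFamily_timeFreqShift_neg fc k n
    have := integrable_norm_shiftPairing_mul hs hf hg p' ((continuous_seminorm k n).comp hcont)
      (fun p => apply_nonneg _ _) hC h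
    refine this.congr (ae_of_all _ fun p => ?_)
    simp only [hF, map_smul_eq_mul, Function.comp_apply]
  have hpt : ∀ t, Integrable fun p : Ed d × Ed d =>
      shiftPairing f g p p' * timeFreqShift fc (p.1, -p.2) t := fun t => by
    have hc : Continuous fun p : Ed d × Ed d => timeFreqShift fc (p.1, -p.2) t := by
      simp_rw [timeFreqShift_apply]
      have := fc.continuous
      fun_prop
    refine (hFint 0 0).mono' ((continuous_shiftPairing f g p').mul hc).aestronglyMeasurable
      (ae_of_all _ fun p => ?_)
    have := SchwartzMap.norm_le_seminorm ℂ (F p) t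
    simpa [hF] using this
  have key := tempered_apply_integral (μ := volume) u hFc hFint
    (G := ((∫ x, ‖f x‖ ^ 2 : ℝ) : ℂ) • timeFreqShift g p') fun t => by
      rw [smul_apply, smul_eq_mul, ← integral_shiftPairing_mul f fc g hfc p' t (hpt t)]
      rfl
  have hnn : 0 ≤ ∫ x, ‖f x‖ ^ 2 := integral_nonneg fun x => by positivity
  rw [map_smul] at key
  calc (∫ x, ‖f x‖ ^ 2) * ‖u (timeFreqShift g p')‖
      = ‖((∫ x, ‖f x‖ ^ 2 : ℝ) : ℂ) • u (timeFreqShift g p')‖ := by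
        rw [norm_smul, Complex.norm_real, Real.norm_of_nonneg hnn]
    _ ≤ ∫ p, ‖u (F p)‖ := by
        rw [key]
        exact norm_integral_le_integral_norm _
    _ = _ := by
        congr 1 with p
        rw [hF, map_smul, norm_smul, mul_comm]

lemma integral_norm_sq_pos {f : SchwartzMap (Ed d) ℂ} (hf : ⇑f ≠ 0) : 0 < ∫ x, ‖f x‖ ^ 2 := by
  obtain ⟨x, hx⟩ := Function.ne_iff.1 hf
  have h_int : Integrable fun x => ‖f x‖ ^ 2 :=
    (memLp_two_iff_integrable_sq_norm f.continuous.aestronglyMeasurable).1 (f.memLp 2)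
  exact integral_pos_of_integrable_nonneg_nonzero (x := x) (f.continuous.norm.pow 2) h_int
    (fun x => by positivity) (pow_ne_zero 2 (norm_ne_zero_iff.2 hx))

end WindowChange

section WaveFront

variable {d : ℕ}

/-- The short-time Fourier transform, with the window given through its complex conjugate. -/
def windowTransform (u : TD d) (g : SchwartzMap (Ed d) ℂ) (z : Ed d × Ed d) : ℂ :=
  u (timeFreqShift g (z.1, -((2 * Real.pi)⁻¹ • z.2)))

lemma timeFreqShift_neg_inv_smul (g : SchwartzMap (Ed d) ℂ) (x ξ t : Ed d) :
    timeFreqShift g (x, -((2 * Real.pi)⁻¹ • ξ)) t =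
      g (t - x) * Complex.exp (-(Complex.I * (⟪t, ξ⟫ : ℝ))) := by
  have hpi : (Real.pi : ℂ) ≠ 0 := Complex.ofReal_ne_zero.2 Real.pi_ne_zero
  rw [timeFreqShift_apply, inner_neg_right, real_inner_smul_right, mul_comm]
  congr 2
  push_cast
  field_simp

lemma IsSTFT.eq_windowTransform {u : TD d} {φ : Ed d → ℂ} {W : Ed d × Ed d → ℂ}
    (h : IsSTFT u φ W) {g : SchwartzMap (Ed d) ℂ} (hg : ⇑g = fun x => (starRingEnd ℂ) (φ x))
    (z : Ed d × Ed d) : W z = windowTransform u g z :=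
  h z.1 z.2 _ fun t => by rw [timeFreqShift_neg_inv_smul, hg]

/-- Covariance of the short-time Fourier transform under phase-space translations. -/
lemma norm_windowTransform_translate {u v : TD d} {y η : Ed d}
    (hv : ∀ ψ ψ' : SchwartzMap (Ed d) ℂ,
      (∀ t : Ed d, ψ' t = Complex.exp (Complex.I * ((⟪t + y, η⟫ : ℝ) : ℂ)) * ψ (t + y)) →
      v ψ = u ψ') (g : SchwartzMap (Ed d) ℂ) (z : Ed d × Ed d) :
    ‖windowTransform v g z‖ = ‖windowTransform u g (z - (y, η))‖ := by
  obtain ⟨x, ξ⟩ := z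
  rw [windowTransform, windowTransform, hv _ (Complex.exp (((⟪y, η - ξ⟫ : ℝ) : ℂ) * Complex.I) •
    timeFreqShift g (x - y, -((2 * Real.pi)⁻¹ • (ξ - η)))) fun t => ?_]
  · rw [map_smul, norm_smul, Complex.norm_exp_ofReal_mul_I, one_mul]
    rfl
  · rw [smul_apply, timeFreqShift_neg_inv_smul, timeFreqShift_neg_inv_smul, smul_eq_mul,
      mul_left_comm, mul_left_comm (Complex.exp (Complex.I * _)), ← Complex.exp_add,
      ← Complex.exp_add, show t - (x - y) = t + y - x by abel]
    congr 2
    simp only [inner_sub_right, inner_add_left]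
    push_cast
    ring

lemma exists_norm_windowTransform_le (u : TD d) (g : SchwartzMap (Ed d) ℂ) :
    ∃ (C : ℝ) (N : ℕ), 0 ≤ C ∧ ∀ z, ‖windowTransform u g z‖ ≤ C * (1 + ‖z‖) ^ N := by
  obtain ⟨C, N, hC, h⟩ := (temperateFamily_timeFreqShift_neg g).norm_apply_le
    (fun p => le_add_of_nonneg_right (norm_nonneg p)) u
  refine ⟨C, N, hC, fun z => (h (z.1, (2 * Real.pi)⁻¹ • z.2)).trans ?_⟩
  have : ‖(z.1, (2 * Real.pi)⁻¹ • z.2)‖ ≤ ‖z‖ := by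
    rw [Prod.norm_mk, Prod.norm_def]
    refine max_le_max le_rfl ?_
    rw [norm_smul, Real.norm_of_nonneg (by positivity)]
    exact mul_le_of_le_one_left (norm_nonneg _)
      (inv_le_one_of_one_le₀ (by linarith [Real.two_le_pi]))
  gcongr

/-- Superexponential decay of the short-time Fourier transform on cones is independent of the
window and of translations. -/
theorem SuperexpDecayNear.windowTransform_of_windowTransform [NeZero d] {s : ℝ} (hs : 0 < s)
    (u : TD d) {f fc g : SchwartzMap (Ed d) ℂ} (hf0 : ⇑f ≠ 0) (hf : HasGSDecay s f) (hg : HasGSDecay s g)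
    (hfc : ⇑fc = fun x => (starRingEnd ℂ) (f x)) (b b' : Ed d × Ed d) {z₀ : Ed d × Ed d}
    (hz₀ : z₀ ≠ 0)
    (h : SuperexpDecayNear s z₀ fun z => ‖windowTransform u fc (z + b)‖) :
    SuperexpDecayNear s z₀ fun z => ‖windowTransform u g (z + b')‖ := by
  have hI := integral_norm_sq_pos hf0
  have hpi : (0 : ℝ) < 2 * Real.pi := by positivity
  obtain ⟨C, N, hC, hV⟩ := exists_norm_windowTransform_le u fc
  set D : Ed d × Ed d → Ed d × Ed d := fun p => (p.1, (2 * Real.pi) • p.2)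
  set S : Ed d × Ed d → Ed d × Ed d := fun z => (z.1, -((2 * Real.pi)⁻¹ • z.2))
  have hR : ∀ p z : Ed d × Ed d,
      (p.1 - (S z).1, (2 * Real.pi) • (p.2 + (S z).2)) = D p - z := fun p z => by
    refine Prod.ext rfl ?_
    simp only [D, S, smul_add, smul_neg, smul_inv_smul₀ hpi.ne', sub_eq_add_neg,
      Prod.snd_add, Prod.snd_neg]
  refine h.of_integral (μ := volume) (κ := fun p z => ‖shiftPairing f g p (S (z + b'))‖)
    (P := fun p => D p - b) (Q := fun z => ((z + b').1, (2 * Real.pi)⁻¹ • (z + b').2))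
    (R := fun p z => ‖D p - (z + b')‖) (a := ‖b' - b‖) (C₀ := C * (1 + ‖b‖) ^ N) (N := N)
    (c := (∫ x, ‖f x‖ ^ 2)⁻¹) hs (fun z => norm_nonneg _) (by positivity) (fun z => ?_)
    (fun p z => norm_nonneg _) (norm_nonneg _) (fun p z => ?_) (fun p z => ?_) (fun A hA => ?_)
    (by positivity) (fun z => ?_) hz₀
  · refine (hV _).trans ?_
    rw [mul_assoc, ← mul_pow]
    have h1 := norm_add_le z b
    have : 1 + ‖z + b‖ ≤ (1 + ‖b‖) * (1 + ‖z‖) := by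
      nlinarith [norm_nonneg z, norm_nonneg b]
    gcongr
  · calc ‖D p - b - z‖ = ‖(D p - (z + b')) + (b' - b)‖ := by congr 1; abel
      _ ≤ _ := norm_add_le _ _
  · have h1 := norm_sub_neg_le p (S (z + b'))
    rw [hR] at h1
    simpa only [S, neg_neg] using h1
  · obtain ⟨B, hB, h1⟩ := norm_shiftPairing_le hs hf hg hA
    refine ⟨B, hB, fun p z => ?_⟩
    have h2 := h1 p (S (z + b'))
    rwa [hR] at h2
  · rw [inv_mul_eq_div, le_div_iff₀ hI, mul_comm]
    refine (norm_apply_timeFreqShift_le hs u hf hg hfc (S (z + b'))).trans (le_of_eq ?_)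
    congr 1 with p
    rw [sub_add_cancel, windowTransform, inv_smul_smul₀ hpi.ne']

lemma norm_le_pnorm (z : Ed d × Ed d) : ‖z‖ ≤ pnorm z :=
  max_le (Real.le_sqrt_of_sq_le (le_add_of_nonneg_right (by positivity)))
    (Real.le_sqrt_of_sq_le (le_add_of_nonneg_left (by positivity)))

lemma pnorm_le_two_mul_norm (z : Ed d × Ed d) : pnorm z ≤ 2 * ‖z‖ := by
  have h1 := norm_fst_le z
  have h2 := norm_snd_le z
  refine Real.sqrt_le_iff.2 ⟨by positivity, ?_⟩
  nlinarith [norm_nonneg z.1, norm_nonneg z.2]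

lemma superexpDecayOn_iff_pnorm {s : ℝ} (hs : 0 < s) (Γ : Set (Ed d × Ed d))
    (W : Ed d × Ed d → ℂ) : SuperexpDecayOn s Γ (fun z => ‖W z‖) ↔
      ∀ A : ℝ, 0 < A → ∃ C : ℝ, ∀ z ∈ Γ, Real.exp (A * pnorm z ^ (1/s)) * ‖W z‖ ≤ C := by
  refine ⟨fun h A hA => ?_, fun h A hA => ?_⟩
  · obtain ⟨C, hC⟩ := h (A * 2 ^ (1 / s)) (by positivity)
    refine ⟨C, fun z hz => le_trans ?_ (hC z hz)⟩
    have h1 : pnorm z ^ (1 / s) ≤ 2 ^ (1 / s) * ‖z‖ ^ (1 / s) := by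
      rw [← Real.mul_rpow (by positivity) (by positivity)]
      exact Real.rpow_le_rpow (Real.sqrt_nonneg _) (pnorm_le_two_mul_norm z) (by positivity)
    rw [mul_assoc A]
    gcongr
  · obtain ⟨C, hC⟩ := h A hA
    refine ⟨C, fun z hz => le_trans ?_ (hC z hz)⟩
    have := norm_le_pnorm z
    gcongr

lemma mem_WFs_iff {s : ℝ} (hs : 0 < s) (W : Ed d × Ed d → ℂ) (z₀ : Ed d × Ed d) :
    z₀ ∈ WFs s W ↔ z₀ ≠ 0 ∧ ¬ SuperexpDecayNear s z₀ fun z => ‖W z‖ := by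
  simp only [WFs, Set.mem_ofPred_eq, SuperexpDecayNear, superexpDecayOn_iff_pnorm hs]

end WaveFront

theorem statement12 (d : ℕ) (s : ℝ) (hs : 1/2 < s)
    (u v : TD d) (y η : Ed d)
    (hv : ∀ ψ ψ' : SchwartzMap (Ed d) ℂ,
      (∀ t : Ed d, ψ' t = Complex.exp (Complex.I * ((⟪t + y, η⟫ : ℝ) : ℂ)) * ψ (t + y)) →
      v ψ = u ψ')
    (φ w : Ed d → ℂ) (hφ : φ ∈ SigmaGS s d) (hφ0 : φ ≠ 0)
    (hw : w ∈ SigmaGS s d) (hw0 : w ≠ 0)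
    (Wu Wv : Ed d × Ed d → ℂ) (hWu : IsSTFT u φ Wu) (hWv : IsSTFT v w Wv) :
    WFs s Wv = WFs s Wu := by
  have hs0 : 0 < s := by linarith
  ext z₀
  rw [mem_WFs_iff hs0, mem_WFs_iff hs0]
  refine and_congr_right fun hz₀ => not_congr ?_
  rcases Nat.eq_zero_or_pos d with rfl | hd
  · exact absurd (Subsingleton.elim _ _) hz₀
  have : NeZero d := ⟨hd.ne'⟩
  obtain ⟨f, rfl⟩ := exists_schwartzMap_of_mem_SigmaGS hφ
  obtain ⟨g, rfl⟩ := exists_schwartzMap_of_mem_SigmaGS hw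
  obtain ⟨fc, hfc⟩ := exists_schwartzMap_conj f
  obtain ⟨gc, hgc⟩ := exists_schwartzMap_conj g
  have hf := hasGSDecay_of_mem_SigmaGS hs0 hφ
  have hg := hasGSDecay_of_mem_SigmaGS hs0 hw
  have hu' : (fun z => ‖Wu z‖) = fun z => ‖windowTransform u fc (z + 0)‖ := by
    ext z
    rw [hWu.eq_windowTransform hfc, add_zero]
  have hv' : (fun z => ‖Wv z‖) = fun z => ‖windowTransform u gc (z + -(y, η))‖ := by
    ext z
    rw [hWv.eq_windowTransform hgc, norm_windowTransform_translate hv, sub_eq_add_neg]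
  rw [hu', hv']
  exact ⟨.windowTransform_of_windowTransform hs0 u hw0 hg (hf.conj hfc) hgc _ _ hz₀,
    .windowTransform_of_windowTransform hs0 u hφ0 hf (hg.conj hgc) hfc _ _ hz₀⟩

end
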